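/- Let v ∈ ℝ^N with S = supp(v) and s = |S|, and assume ln(N/2) ≤ s ≤ N/8 and m ≤ N/9. Let U ∈ ℝ^{m×N} be random with i.i.d. standard Gaussian N(0,1) entries and b = Uv. There exists a universal constant c̄ ≥ 1 and positive universal constants C₁, C₂ with the following property: if (i) m > (1+ε) · 12 s ln(N−s) for some ε ∈ (0,1/2) with ε > 8√(s/m), (ii) c̄λ < 2m · min_{j∈S}|v_j| − 1/N², and (iii) λ ≥ 2/N², then with probability at least 1 − C₁ N^{−C₂} the following both hold: C_UL(b,U) < 542062 · N^{7.5} · ⟨v⟩₂⁵, and the LASSO problem Sol(b,U) has a unique minimiser x, which satisfies supp(x) = S. -/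

import Mathlib

open MeasureTheory ProbabilityTheory Filter Real Set
open scoped ENNReal NNReal

noncomputable section

/-- The LASSO objective function `‖Ax - y‖₂² + λ‖x‖₁`. -/
def lassoObj {m N : ℕ} (lam : ℝ) (y : Fin m → ℝ) (A : Matrix (Fin m) (Fin N) ℝ)
    (x : Fin N → ℝ) : ℝ :=
  (∑ i, (A.mulVec x i - y i) ^ 2) + lam * ∑ j, |x j|

/-- The LASSO solution set `Sol(y,A)`. -/
def Sol {m N : ℕ} (lam : ℝ) (y : Fin m → ℝ) (A : Matrix (Fin m) (Fin N) ℝ) :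
    Set (Fin N → ℝ) :=
  {x | ∀ z, lassoObj lam y A x ≤ lassoObj lam y A z}

/-- Support of a vector. -/
def supp {N : ℕ} (x : Fin N → ℝ) : Set (Fin N) := {i | x i ≠ 0}

/-- Stability support: distance to support change. -/
def stsp {m N : ℕ} (lam : ℝ) (y : Fin m → ℝ) (A : Matrix (Fin m) (Fin N) ℝ) : ℝ :=
  sInf {δ : ℝ | 0 ≤ δ ∧ ∃ (y' : Fin m → ℝ) (A' : Matrix (Fin m) (Fin N) ℝ)
    (x x' : Fin N → ℝ), x ∈ Sol lam y A ∧ x' ∈ Sol lam y' A' ∧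
    (∀ i, |y' i - y i| ≤ δ) ∧ (∀ i j, |A' i j - A i j| ≤ δ) ∧ supp x ≠ supp x'}

/-- The LASSO condition number `C_UL(y,A)`; it is `∞` when `stsp(y,A) = 0`. -/
def condUL {m N : ℕ} (lam : ℝ) (y : Fin m → ℝ) (A : Matrix (Fin m) (Fin N) ℝ) : ℝ≥0∞ :=
  if stsp lam y A = 0 then ⊤ else ENNReal.ofReal (1 / stsp lam y A)

/-- `m = 1` case: identify `ℝ^{1×N}` with `ℝ^N` and `ℝ^1` with `ℝ`. -/
def Sol1 {N : ℕ} (lam : ℝ) (y : ℝ) (A : Fin N → ℝ) : Set (Fin N → ℝ) :=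
  Sol lam (fun _ : Fin 1 => y) (Matrix.of fun _ j => A j)

def stsp1 {N : ℕ} (lam : ℝ) (y : ℝ) (A : Fin N → ℝ) : ℝ :=
  stsp lam (fun _ : Fin 1 => y) (Matrix.of fun _ j => A j)

/-- Euclidean norm on `ℝ^k`. -/
def l2norm {k : ℕ} (x : Fin k → ℝ) : ℝ := Real.sqrt (∑ i, x i ^ 2)

/-- Spectral norm (operator `2`-norm) of a matrix. -/
def specNorm {m N : ℕ} (A : Matrix (Fin m) (Fin N) ℝ) : ℝ :=
  sSup {v | ∃ x : Fin N → ℝ, l2norm x ≤ 1 ∧ v = l2norm (A.mulVec x)}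

/-- The truncated norm `⦀(y,A)⦀₂ = max{‖A‖₂, ‖y‖₂, 1}`. -/
def trNorm2 {m N : ℕ} (y : Fin m → ℝ) (A : Matrix (Fin m) (Fin N) ℝ) : ℝ :=
  max (specNorm A) (max (l2norm y) 1)

/-- The polynomial `q(ν,ξ) = 96ν⁵ + 12ν³(1 + λ√N)√ξ + ξ(2ν³/λ + 3ν)`. -/
def qpoly (N : ℕ) (lam ν ξ : ℝ) : ℝ :=
  96 * ν ^ 5 + 12 * ν ^ 3 * (1 + lam * Real.sqrt N) * Real.sqrt ξ +
    ξ * (2 * ν ^ 3 / lam + 3 * ν)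

/-- `‖A_{Sᶜ}ᵀ(Ax − y)‖_∞` where `S = supp x` (equal to `0` when `Sᶜ = ∅`). -/
def dualInfNorm {m N : ℕ} (y : Fin m → ℝ) (A : Matrix (Fin m) (Fin N) ℝ)
    (x : Fin N → ℝ) : ℝ :=
  sSup {v | ∃ j, j ∉ supp x ∧ v = |∑ i, A i j * (A.mulVec x i - y i)|}

/-- `σ₁(y,A) = inf{λ/2 − ‖A_{Sᶜ}ᵀ(Ax − y)‖_∞ : x ∈ Sol(y,A), S = supp x}` (in `[0,∞]`,
with `inf ∅ = ∞`). -/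
def sigma1 {m N : ℕ} (lam : ℝ) (y : Fin m → ℝ) (A : Matrix (Fin m) (Fin N) ℝ) : ℝ≥0∞ :=
  sInf {t | ∃ x ∈ Sol lam y A, t = ENNReal.ofReal (lam / 2 - dualInfNorm y A x)}

open scoped Classical in
/-- `‖(A_Sᵀ A_S)^{−1}‖₂^{−1}`, i.e. the smallest eigenvalue of the Gram matrix `A_Sᵀ A_S`
(`0` when the Gram matrix is singular, `∞` when `S = ∅`). -/
def gramInvNormInv {m N : ℕ} (A : Matrix (Fin m) (Fin N) ℝ) (S : Set (Fin N)) : ℝ≥0∞ :=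
  if S = ∅ then ⊤ else
    ENNReal.ofReal (sInf {v | ∃ z : Fin N → ℝ, (∀ j, j ∉ S → z j = 0) ∧
      (∑ j, z j ^ 2) = 1 ∧ v = ∑ i, (A.mulVec z i) ^ 2})

/-- `σ₂(y,A)`. -/
def sigma2 {m N : ℕ} (lam : ℝ) (y : Fin m → ℝ) (A : Matrix (Fin m) (Fin N) ℝ) : ℝ≥0∞ :=
  sInf {t | ∃ x ∈ Sol lam y A, t = gramInvNormInv A (supp x)}

/-- `σ₃(y,A) = inf{|x_i| : x ∈ Sol(y,A), x_i ≠ 0}` (with `inf ∅ = ∞`). -/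
def sigma3 {m N : ℕ} (lam : ℝ) (y : Fin m → ℝ) (A : Matrix (Fin m) (Fin N) ℝ) : ℝ≥0∞ :=
  sInf {t | ∃ (i : Fin N) (x : Fin N → ℝ), x ∈ Sol lam y A ∧ x i ≠ 0 ∧
    t = ENNReal.ofReal |x i|}

/-- `σ(y,A) = min{σ₁(y,A), σ₂(y,A)², σ₃(y,A)}`. -/
def sigmaUL {m N : ℕ} (lam : ℝ) (y : Fin m → ℝ) (A : Matrix (Fin m) (Fin N) ℝ) : ℝ≥0∞ :=
  min (sigma1 lam y A) (min ((sigma2 lam y A) ^ 2) (sigma3 lam y A))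

/-- `R : Ω → ℝ^k` is a centered Gaussian vector with covariance `Sig`: every linear
functional `⟨u, R⟩` is distributed as `N(0, uᵀ Sig u)`. -/
def IsCenteredGaussianVector {k : ℕ} {Ω : Type*} [MeasurableSpace Ω] (μ : Measure Ω)
    (Sig : Matrix (Fin k) (Fin k) ℝ) (R : Ω → Fin k → ℝ) : Prop :=
  ∀ u : Fin k → ℝ,
    Measure.map (fun ω => ∑ j, u j * R ω j) μ =
      gaussianReal 0 (Real.toNNReal (∑ j, ∑ l, u j * Sig j l * u l))

/-- Minimal eigenvalue of `Σ_{SS}` (Rayleigh quotient over unit vectors supported on `S`). -/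
def CminOf {N : ℕ} (Sig : Matrix (Fin N) (Fin N) ℝ) (S : Finset (Fin N)) : ℝ :=
  sInf {r | ∃ z : Fin N → ℝ, (∀ j ∉ S, z j = 0) ∧ (∑ j, z j ^ 2) = 1 ∧
    r = ∑ j, ∑ l, z j * Sig j l * z l}

/-- Maximal eigenvalue of `Σ_{SS}`. -/
def CmaxOf {N : ℕ} (Sig : Matrix (Fin N) (Fin N) ℝ) (S : Finset (Fin N)) : ℝ :=
  sSup {r | ∃ z : Fin N → ℝ, (∀ j ∉ S, z j = 0) ∧ (∑ j, z j ^ 2) = 1 ∧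
    r = ∑ j, ∑ l, z j * Sig j l * z l}

/-- Maximum absolute row sum norm `‖M‖_∞`. -/
def rowSumNorm {a b : Type*} [Fintype a] [Fintype b] (M : Matrix a b ℝ) : ℝ :=
  sSup (Set.range fun i : a => ∑ j, |M i j|)

/-- Submatrix `Σ_{ST}` of `Σ` with rows indexed by `S` and columns by `T`. -/
def subm {N : ℕ} (Sig : Matrix (Fin N) (Fin N) ℝ) (S T : Finset (Fin N)) :
    Matrix {i // i ∈ S} {j // j ∈ T} ℝ :=
  Matrix.of fun i j => Sig i.1 j.1

/-- `γ = 1 − ‖Σ_{SᶜS}(Σ_{SS})^{−1}‖_∞`. -/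
def gammaOf {N : ℕ} (Sig : Matrix (Fin N) (Fin N) ℝ) (S : Finset (Fin N)) : ℝ :=
  1 - rowSumNorm (subm Sig Sᶜ S * (subm Sig S S)⁻¹)

/-- `Σ_{Sᶜ|S} = Σ_{SᶜSᶜ} − Σ_{SᶜS}(Σ_{SS})^{−1}Σ_{SSᶜ}`. -/
def condCov {N : ℕ} (Sig : Matrix (Fin N) (Fin N) ℝ) (S : Finset (Fin N)) :
    Matrix {i // i ∈ Sᶜ} {j // j ∈ Sᶜ} ℝ :=
  subm Sig Sᶜ Sᶜ - subm Sig Sᶜ S * (subm Sig S S)⁻¹ * subm Sig S Sᶜ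

/-- `ρ_u`: maximal diagonal entry of `Σ_{Sᶜ|S}`. -/
def rhoUOf {N : ℕ} (Sig : Matrix (Fin N) (Fin N) ℝ) (S : Finset (Fin N)) : ℝ :=
  sSup (Set.range fun i : {j // j ∈ Sᶜ} => condCov Sig S i i)

/-- `θ_u = ρ_u/(C_min γ²)`. -/
def thetaUOf {N : ℕ} (Sig : Matrix (Fin N) (Fin N) ℝ) (S : Finset (Fin N)) : ℝ :=
  rhoUOf Sig S / (CminOf Sig S * gammaOf Sig S ^ 2)

/-- `φ_N = λ²/(8η² ln(N) C_min θ_u m)`. -/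
def phiNOf {N : ℕ} (lam η : ℝ) (m : ℕ) (Sig : Matrix (Fin N) (Fin N) ℝ)
    (S : Finset (Fin N)) : ℝ :=
  lam ^ 2 / (8 * η ^ 2 * Real.log N * CminOf Sig S * thetaUOf Sig S * m)

open scoped ComplexOrder in
/-- The positive semidefinite square root of a positive semidefinite matrix. -/
def Matrix.PosSemidef.sqrt {n 𝕜 : Type*} [Fintype n] [RCLike 𝕜] [DecidableEq n]
    {A : Matrix n n 𝕜} (hA : A.PosSemidef) : Matrix n n 𝕜 :=
  hA.1.eigenvectorUnitary.1 * Matrix.diagonal ((↑) ∘ Real.sqrt ∘ hA.1.eigenvalues) *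
    (star hA.1.eigenvectorUnitary : Matrix n n 𝕜)

open scoped Classical in
/-- `Σ^{−1/2}`: the inverse of the positive semidefinite square root of `Σ`. -/
def sqrtInvMat {N : ℕ} (Sig : Matrix (Fin N) (Fin N) ℝ) : Matrix (Fin N) (Fin N) ℝ :=
  (if h : Sig.PosSemidef then h.sqrt else 1)⁻¹

/-- `g(λ) = c₃λ‖Σ^{−1/2}‖_∞²/(2m) + 20√(η² ln(s)/(C_min m))`. -/
def gOf {N : ℕ} (c3 lam η : ℝ) (m : ℕ) (Sig : Matrix (Fin N) (Fin N) ℝ)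
    (S : Finset (Fin N)) : ℝ :=
  c3 * lam * (rowSumNorm (sqrtInvMat Sig)) ^ 2 / (2 * m) +
    20 * Real.sqrt (η ^ 2 * Real.log S.card / (CminOf Sig S * m))

/-- `M̄_N(ε) = (1+ε)/(C_min θ_u m) · (s θ_u + m/(2 ln(N) φ_N))`. -/
def MbarOf {N : ℕ} (lam η : ℝ) (m : ℕ) (Sig : Matrix (Fin N) (Fin N) ℝ)
    (S : Finset (Fin N)) (ε : ℝ) : ℝ :=
  (1 + ε) / (CminOf Sig S * thetaUOf Sig S * m) *
    (S.card * thetaUOf Sig S + m / (2 * Real.log N * phiNOf lam η m Sig S))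

/-- `min_{j ∈ supp v} |v_j|`. -/
def minAbsOn {N : ℕ} (v : Fin N → ℝ) : ℝ :=
  sInf {r | ∃ j, v j ≠ 0 ∧ r = |v j|}

open scoped Classical in
/-- The support of `v` as a `Finset`. -/
def suppF {N : ℕ} (v : Fin N → ℝ) : Finset (Fin N) :=
  Finset.univ.filter fun j => v j ≠ 0

section GaussianTails

variable {Ω : Type*} [MeasurableSpace Ω] {μ : Measure Ω}

theorem map_sum_mul_gaussian [IsProbabilityMeasure μ] {ι : Type*} {X : ι → Ω → ℝ}
    (hX : ∀ i, Measurable (X i)) (hind : iIndepFun X μ)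
    (hlaw : ∀ i, μ.map (X i) = gaussianReal 0 1) (c : ι → ℝ) (s : Finset ι) :
    μ.map (fun ω => ∑ i ∈ s, c i * X i ω) = gaussianReal 0 (∑ i ∈ s, c i ^ 2).toNNReal := by
  classical
  have hmul : ∀ i, μ.map (fun ω => c i * X i ω) = gaussianReal 0 (c i ^ 2).toNNReal := by
    intro i
    have h := Measure.map_map (μ := μ) (g := fun x : ℝ => c i * x) (f := X i)
      (by fun_prop) (hX i)
    rw [hlaw, gaussianReal_map_const_mul] at h
    have h2 : ((fun x : ℝ => c i * x) ∘ X i) = fun ω => c i * X i ω := rfl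
    rw [h2] at h
    rw [← h]
    congr 1
    · simp
    · ext; simp [Real.coe_toNNReal _ (sq_nonneg (c i))]
  have hind' : iIndepFun (fun i ω => c i * X i ω) μ :=
    hind.comp (fun i x => c i * x) (fun i => by fun_prop)
  induction s using Finset.induction_on with
  | empty => simp [gaussianReal_zero_var, Measure.map_const]
  | insert i s hi ih =>
    have h1 : IndepFun (∑ j ∈ s, fun ω => c j * X j ω) (fun ω => c i * X i ω) μ :=
      hind'.indepFun_finsetSum_of_notMem (fun j => by have := hX j; fun_prop) hi
    have hsum : (∑ j ∈ s, fun ω => c j * X j ω) = fun ω => ∑ j ∈ s, c j * X j ω := by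
      ext ω; simp
    rw [hsum] at h1
    have h2 := gaussianReal_add_gaussianReal_of_indepFun h1 ih (hmul i)
    have h3 : ((fun ω => ∑ j ∈ s, c j * X j ω) + fun ω => c i * X i ω)
        = fun ω => ∑ j ∈ insert i s, c j * X j ω := by
      ext ω; simp [Finset.sum_insert hi, add_comm]
    rw [h3] at h2
    rw [h2, add_zero, Finset.sum_insert hi,
      Real.toNNReal_add (sq_nonneg _) (Finset.sum_nonneg fun j _ => sq_nonneg _), add_comm]

theorem gaussianReal_abs_tail {X : Ω → ℝ} {v : ℝ≥0} [IsProbabilityMeasure μ]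
    (hlaw : μ.map X = gaussianReal 0 v) {t r : ℝ} (ht : 0 ≤ t)
    (hr : 0 < r) (hv : (v : ℝ) ≤ r) :
    μ {ω | t < |X ω|} ≤ ENNReal.ofReal (2 * exp (-t ^ 2 / (2 * r))) := by
  have hXm : AEMeasurable X μ := by
    apply AEMeasurable.of_map_ne_zero; simp [NeZero.ne, hlaw]
  have hsub : HasSubgaussianMGF X r.toNNReal μ := by
    refine ⟨fun s => ?_, fun s => ?_⟩
    · have := integrable_exp_mul_gaussianReal (μ := 0) (v := v) s
      rw [← hlaw] at this
      exact this.comp_aemeasurable hXm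
    · rw [mgf_gaussianReal hlaw]
      apply exp_le_exp.2
      rw [Real.coe_toNNReal r hr.le, zero_mul, zero_add]
      gcongr
  have h1 := hsub.measure_ge_le ht
  have h2 := hsub.neg.measure_ge_le ht
  rw [Real.coe_toNNReal r hr.le] at h1 h2
  have hsubset : {ω | t < |X ω|} ⊆ {ω | t ≤ X ω} ∪ {ω | t ≤ (-X) ω} := by
    intro ω hω
    rcases lt_abs.1 (show t < |X ω| from hω) with h | h
    · exact Or.inl h.le
    · exact Or.inr h.le
  refine (measure_mono hsubset).trans ((measure_union_le _ _).trans ?_)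
  rw [two_mul, ENNReal.ofReal_add (exp_pos _).le (exp_pos _).le]
  refine add_le_add ?_ ?_
  · rw [← ENNReal.ofReal_toReal (measure_ne_top μ {ω | t ≤ X ω})]
    exact ENNReal.ofReal_le_ofReal h1
  · rw [← ENNReal.ofReal_toReal (measure_ne_top μ {ω | t ≤ (-X) ω})]
    exact ENNReal.ofReal_le_ofReal h2

theorem gaussianPDF_mul_exp_sq {v : ℝ≥0} (hv : v ≠ 0) {t : ℝ} (x : ℝ) :
    gaussianPDFReal 0 v x * exp (t * x ^ 2)
      = (√(2 * π * v))⁻¹ * exp (-(1 / (2 * v) - t) * x ^ 2) := by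
  have hv' : (v : ℝ) ≠ 0 := by exact_mod_cast hv
  rw [gaussianPDFReal, mul_assoc, ← exp_add]
  congr 2
  field_simp
  ring

theorem integrable_exp_mul_sq_gaussianReal {v : ℝ≥0} (hv : v ≠ 0) {t : ℝ}
    (ht : 2 * t * v < 1) : Integrable (fun x => exp (t * x ^ 2)) (gaussianReal 0 v) := by
  have hv' : (0 : ℝ) < v := by exact_mod_cast pos_iff_ne_zero.2 hv
  rw [gaussianReal_of_var_ne_zero _ hv,
    integrable_withDensity_iff_integrable_smul' (measurable_gaussianPDF _ _)
      (ae_of_all _ fun _ => gaussianPDF_lt_top)]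
  simp only [toReal_gaussianPDF, smul_eq_mul, gaussianPDF_mul_exp_sq hv]
  refine (integrable_exp_neg_mul_sq ?_).const_mul _
  rw [sub_pos, lt_div_iff₀ (by positivity)]
  linarith

theorem integral_exp_mul_sq_gaussianReal {v : ℝ≥0} (hv : v ≠ 0) {t : ℝ}
    (ht : 2 * t * v < 1) :
    ∫ x, exp (t * x ^ 2) ∂(gaussianReal 0 v) = (√(1 - 2 * t * v))⁻¹ := by
  have hv' : (0 : ℝ) < v := by exact_mod_cast pos_iff_ne_zero.2 hv
  rw [integral_gaussianReal_eq_integral_smul hv]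
  simp only [smul_eq_mul, gaussianPDF_mul_exp_sq hv]
  rw [integral_const_mul, integral_gaussian, ← Real.sqrt_inv, ← Real.sqrt_inv,
    ← Real.sqrt_mul (by positivity)]
  congr 1
  have h1 : (1 - 2 * t * v) ≠ 0 := by linarith
  have h2 : 1 / (2 * (v : ℝ)) - t = (1 - 2 * t * v) / (2 * v) := by field_simp
  rw [h2]
  have := pi_pos.ne'
  field_simp

theorem mgf_sum_sq_gaussian [IsProbabilityMeasure μ] {m : ℕ} {g : Fin m → Ω → ℝ} {v : ℝ≥0}
    (hv : v ≠ 0) (hg : ∀ i, Measurable (g i)) (hind : iIndepFun g μ)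
    (hlaw : ∀ i, μ.map (g i) = gaussianReal 0 v) {t : ℝ} (ht : 2 * t * v < 1) :
    mgf (fun ω => ∑ i, g i ω ^ 2) μ t = (√(1 - 2 * t * v))⁻¹ ^ m ∧
      Integrable (fun ω => exp (t * ∑ i, g i ω ^ 2)) μ := by
  have hind' : iIndepFun (fun i ω => g i ω ^ 2) μ :=
    hind.comp (fun i x => x ^ 2) (fun i => by fun_prop)
  have hm : ∀ i, Measurable fun ω => g i ω ^ 2 := fun i => by have := hg i; fun_prop
  have hint : ∀ i, Integrable (fun ω => exp (t * g i ω ^ 2)) μ := by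
    intro i
    have := integrable_exp_mul_sq_gaussianReal hv ht
    rw [← hlaw i] at this
    exact this.comp_measurable (hg i)
  have hone : ∀ i, mgf (fun ω => g i ω ^ 2) μ t = (√(1 - 2 * t * v))⁻¹ := by
    intro i
    rw [← integral_exp_mul_sq_gaussianReal hv ht, ← hlaw i, mgf,
      integral_map (hg i).aemeasurable (by fun_prop)]
  have heq : (∑ i, fun ω => g i ω ^ 2) = fun ω => ∑ i, g i ω ^ 2 := by ext; simp
  constructor
  · have h := hind'.mgf_sum hm Finset.univ (t := t)
    rw [heq] at h
    rw [h]
    simp [hone]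
  · have h := hind'.integrable_exp_mul_sum hm (s := Finset.univ) (t := t) (fun i _ => hint i)
    rwa [heq] at h

theorem sum_sq_gaussian_tail [IsProbabilityMeasure μ] {m : ℕ} {g : Fin m → Ω → ℝ} {v : ℝ≥0}
    (hg : ∀ i, Measurable (g i)) (hind : iIndepFun g μ)
    (hlaw : ∀ i, μ.map (g i) = gaussianReal 0 v) :
    μ {ω | (m : ℝ) / 8 * v < |∑ i, g i ω ^ 2 - m * v|}
      ≤ ENNReal.ofReal (2 * exp (-(m : ℝ) / 512)) := by
  rcases eq_or_ne v 0 with rfl | hv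
  · have h0 : ∀ᵐ ω ∂μ, ∀ i, g i ω = 0 := by
      rw [ae_all_iff]
      intro i
      have h : ∀ᵐ x ∂(μ.map (g i)), x = 0 := by
        rw [hlaw i, gaussianReal_zero_var]
        simp [ae_dirac_eq]
      exact ae_of_ae_map (hg i).aemeasurable h
    have : μ {ω | (m : ℝ) / 8 * (0 : ℝ≥0) < |∑ i, g i ω ^ 2 - m * (0 : ℝ≥0)|} = 0 := by
      refine measure_mono_null ?_ (ae_iff.1 h0)
      intro ω hω hc
      simp [hc] at hω
    rw [this]
    exact zero_le
  have hv' : (0 : ℝ) < v := by exact_mod_cast pos_iff_ne_zero.2 hv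
  obtain ⟨hm1, hi1⟩ := mgf_sum_sq_gaussian hv hg hind hlaw (t := 1 / (32 * v))
    (by field_simp; norm_num)
  obtain ⟨hm2, hi2⟩ := mgf_sum_sq_gaussian hv hg hind hlaw (t := -(1 / (32 * v)))
    (by field_simp; norm_num)
  have hU := measure_ge_le_exp_mul_mgf (m * (9 / 8) * v) (by positivity) hi1
  have hL := measure_le_le_exp_mul_mgf (m * (7 / 8) * v) (by simp) hi2
  have e1 : 1 - 2 * (1 / (32 * v)) * v = (15 / 16 : ℝ) := by field_simp; norm_num
  have e2 : 1 - 2 * -(1 / (32 * v)) * v = (17 / 16 : ℝ) := by field_simp; norm_num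
  rw [hm1, e1] at hU
  rw [hm2, e2] at hL
  have b1 : (√(15 / 16 : ℝ))⁻¹ ≤ exp (17 / 512) := by
    rw [← Real.sqrt_inv, Real.sqrt_le_left (exp_pos _).le, ← exp_nat_mul]
    have := Real.quadratic_le_exp_of_nonneg (x := (2 : ℕ) * (17 / 512)) (by positivity)
    refine le_trans ?_ this
    norm_num
  have b2 : (√(17 / 16 : ℝ))⁻¹ ≤ exp (-15 / 512) := by
    rw [← Real.sqrt_inv, Real.sqrt_le_left (exp_pos _).le, ← exp_nat_mul]
    have := Real.add_one_le_exp ((2 : ℕ) * (-15 / 512 : ℝ))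
    refine le_trans ?_ this
    norm_num
  have hU' : μ.real {ω | m * (9 / 8) * v ≤ ∑ i, g i ω ^ 2} ≤ exp (-(m : ℝ) / 512) := by
    refine hU.trans ((mul_le_mul_of_nonneg_left
      (pow_le_pow_left₀ (by positivity) b1 m) (exp_pos _).le).trans ?_)
    rw [← exp_nat_mul, ← exp_add]
    apply le_of_eq
    congr 1
    field_simp
    ring
  have hL' : μ.real {ω | ∑ i, g i ω ^ 2 ≤ m * (7 / 8) * v} ≤ exp (-(m : ℝ) / 512) := by
    refine hL.trans ((mul_le_mul_of_nonneg_left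
      (pow_le_pow_left₀ (by positivity) b2 m) (exp_pos _).le).trans ?_)
    rw [← exp_nat_mul, ← exp_add]
    apply exp_le_exp.2
    apply le_of_eq
    field_simp
    ring
  have hsubset : {ω | (m : ℝ) / 8 * v < |∑ i, g i ω ^ 2 - m * v|} ⊆
      {ω | m * (9 / 8) * v ≤ ∑ i, g i ω ^ 2} ∪ {ω | ∑ i, g i ω ^ 2 ≤ m * (7 / 8) * v} := by
    intro ω hω
    rcases lt_abs.1 (show (m : ℝ) / 8 * v < |∑ i, g i ω ^ 2 - m * v| from hω) with h | h
    · left; simp only [mem_ofPred_eq]; linarith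
    · right; simp only [mem_ofPred_eq]; linarith
  refine (measure_mono hsubset).trans ((measure_union_le _ _).trans ?_)
  rw [two_mul, ENNReal.ofReal_add (exp_pos _).le (exp_pos _).le]
  refine add_le_add ?_ ?_
  · rw [← ENNReal.ofReal_toReal (measure_ne_top μ {ω | m * (9 / 8) * v ≤ ∑ i, g i ω ^ 2})]
    exact ENNReal.ofReal_le_ofReal hU'
  · rw [← ENNReal.ofReal_toReal (measure_ne_top μ {ω | ∑ i, g i ω ^ 2 ≤ m * (7 / 8) * v})]
    exact ENNReal.ofReal_le_ofReal hL'

end GaussianTails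

section Deterministic

variable {H : Type*} [NormedAddCommGroup H] [InnerProductSpace ℝ H] {N : ℕ}

/-- The linear combination `∑ j, x j • a j` of the columns `a`. -/
abbrev colComb (a : Fin N → H) : (Fin N → ℝ) →ₗ[ℝ] H := Fintype.linearCombination ℝ a

theorem inner_colComb (a : Fin N → H) (x : Fin N → ℝ) (r : H) :
    inner ℝ (colComb a x) r = ∑ j, x j * inner ℝ (a j) r := by
  rw [Fintype.linearCombination_apply, sum_inner]
  simp [real_inner_smul_left]

theorem norm_colComb_le {a : Fin N → H} {η : ℝ} (ha : ∀ j, ‖a j‖ ≤ η) (x : Fin N → ℝ) :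
    ‖colComb a x‖ ≤ η * ∑ j, |x j| := by
  rw [Fintype.linearCombination_apply, Finset.mul_sum]
  refine (norm_sum_le _ _).trans (Finset.sum_le_sum fun j _ => ?_)
  rw [norm_smul, Real.norm_eq_abs, mul_comm]
  exact mul_le_mul_of_nonneg_right (ha j) (abs_nonneg _)

theorem sum_abs_sq_le (x : Fin N → ℝ) : (∑ j, |x j|) ^ 2 ≤ N * ∑ j, x j ^ 2 := by
  have := sq_sum_le_card_mul_sum_sq (s := Finset.univ) (f := fun j => |x j|)
  simpa using this

theorem lasso_lt_of_kkt {a : Fin N → H} {y : H} {lam : ℝ} {x z : Fin N → ℝ}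
    (h0 : ∀ j, |inner ℝ (a j) (y - colComb a x)| ≤ lam / 2)
    (h1 : ∀ j, inner ℝ (a j) (y - colComb a x) * x j = lam / 2 * |x j|)
    (h2 : ∀ j, x j = 0 → |inner ℝ (a j) (y - colComb a x)| < lam / 2)
    (hinj : ∀ u : Fin N → ℝ, (∀ j, x j = 0 → u j = 0) → colComb a u = 0 → u = 0)
    (hz : z ≠ x) :
    ‖colComb a x - y‖ ^ 2 + lam * ∑ j, |x j| < ‖colComb a z - y‖ ^ 2 + lam * ∑ j, |z j| := by
  set r := y - colComb a x with hr
  have hexp : ‖colComb a z - y‖ ^ 2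
      = ‖colComb a (z - x)‖ ^ 2 - 2 * ∑ j, (z - x) j * inner ℝ (a j) r + ‖colComb a x - y‖ ^ 2 := by
    have e1 : colComb a z - y = colComb a (z - x) - r := by rw [map_sub, hr]; abel
    have e2 : ‖colComb a x - y‖ = ‖r‖ := by rw [hr, norm_sub_rev]
    rw [e1, e2, norm_sub_sq_real, inner_colComb]
  have hterm : ∀ j, 0 ≤ lam * |z j| - 2 * (z j * inner ℝ (a j) r) := by
    intro j
    have := le_abs_self (z j * inner ℝ (a j) r)
    rw [abs_mul] at this
    nlinarith [mul_le_mul_of_nonneg_left (h0 j) (abs_nonneg (z j))]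
  have hsum : ‖colComb a z - y‖ ^ 2 + lam * ∑ j, |z j|
      = ‖colComb a x - y‖ ^ 2 + lam * ∑ j, |x j| + (‖colComb a (z - x)‖ ^ 2
        + ∑ j, (lam * |z j| - 2 * (z j * inner ℝ (a j) r))) := by
    have e3 : ∑ j, (z - x) j * inner ℝ (a j) r
        = ∑ j, z j * inner ℝ (a j) r - lam / 2 * ∑ j, |x j| := by
      rw [Finset.mul_sum, ← Finset.sum_sub_distrib]
      refine Finset.sum_congr rfl fun j _ => ?_
      rw [← h1 j, Pi.sub_apply]; ring
    rw [hexp, e3, Finset.sum_sub_distrib, Finset.mul_sum, Finset.mul_sum, Finset.mul_sum]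
    simp only [← Finset.mul_sum]
    ring
  rw [hsum]
  have hS0 : 0 ≤ ∑ j, (lam * |z j| - 2 * (z j * inner ℝ (a j) r)) :=
    Finset.sum_nonneg fun j _ => hterm j
  by_contra hcon
  push Not at hcon
  have hA : ‖colComb a (z - x)‖ ^ 2 = 0 := by nlinarith [sq_nonneg ‖colComb a (z - x)‖]
  have hB : ∑ j, (lam * |z j| - 2 * (z j * inner ℝ (a j) r)) = 0 := by
    nlinarith [sq_nonneg ‖colComb a (z - x)‖]
  rw [Finset.sum_eq_zero_iff_of_nonneg fun j _ => hterm j] at hB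
  apply hz
  rw [← sub_eq_zero]
  refine hinj _ (fun j hj => ?_) (by simpa using hA)
  have hBj := hB j (Finset.mem_univ j)
  rw [Pi.sub_apply, hj, sub_zero]
  by_contra hzj
  have := le_abs_self (z j * inner ℝ (a j) r)
  rw [abs_mul] at this
  nlinarith [mul_lt_mul_of_pos_left (h2 j hj) (abs_pos.2 hzj)]

/-- The Gram matrix of the columns indexed by `T`, extended by the identity outside `T`. -/
def maskedGram (a : Fin N → H) (T : Finset (Fin N)) : Matrix (Fin N) (Fin N) ℝ :=
  Matrix.of fun j k => if j ∈ T ∧ k ∈ T then inner ℝ (a j) (a k) else if j = k then 1 else 0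

/-- The coefficients, supported on `T`, of the combination of the columns in `T` whose inner
products with these columns are prescribed by `c`. -/
def dualCoef (a : Fin N → H) (T : Finset (Fin N)) (c : Fin N → ℝ) : Fin N → ℝ :=
  (maskedGram a T)⁻¹.mulVec fun j => if j ∈ T then c j else 0

theorem maskedGram_mulVec_of_notMem (a : Fin N → H) {T : Finset (Fin N)} {j : Fin N} (hj : j ∉ T)
    (z : Fin N → ℝ) : (maskedGram a T).mulVec z j = z j := by
  simp [Matrix.mulVec, dotProduct, maskedGram, hj]

theorem maskedGram_mulVec_of_mem (a : Fin N → H) {T : Finset (Fin N)} {j : Fin N} (hj : j ∈ T)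
    {z : Fin N → ℝ} (hz : ∀ k ∉ T, z k = 0) :
    (maskedGram a T).mulVec z j = inner ℝ (a j) (colComb a z) := by
  rw [real_inner_comm, inner_colComb]
  simp only [Matrix.mulVec, dotProduct]
  refine Finset.sum_congr rfl fun k _ => ?_
  by_cases hk : k ∈ T
  · simp [maskedGram, hj, hk, real_inner_comm, mul_comm]
  · simp [hz k hk]

theorem dualCoef_spec {a : Fin N → H} {T : Finset (Fin N)}
    (hG : ∀ z : Fin N → ℝ, (∀ j ∉ T, z j = 0) → colComb a z = 0 → z = 0) (c : Fin N → ℝ) :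
    (∀ j ∉ T, dualCoef a T c j = 0) ∧
      ∀ k ∈ T, inner ℝ (a k) (colComb a (dualCoef a T c)) = c k := by
  have hunit : IsUnit (maskedGram a T) := by
    rw [← Matrix.mulVec_injective_iff_isUnit, ← Matrix.coe_mulVecLin, injective_iff_map_eq_zero]
    intro z hz
    rw [Matrix.coe_mulVecLin] at hz
    have hoff : ∀ j ∉ T, z j = 0 := fun j hj => by
      rw [← maskedGram_mulVec_of_notMem a hj z, hz]; rfl
    refine hG z hoff ?_
    rw [← inner_self_eq_zero (𝕜 := ℝ), inner_colComb]
    refine Finset.sum_eq_zero fun j _ => ?_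
    by_cases hj : j ∈ T
    · rw [← maskedGram_mulVec_of_mem a hj hoff, hz]; simp
    · simp [hoff j hj]
  have hmul : (maskedGram a T).mulVec (dualCoef a T c) = fun j => if j ∈ T then c j else 0 := by
    rw [dualCoef, Matrix.mulVec_mulVec, Matrix.mul_nonsing_inv _
      ((Matrix.isUnit_iff_isUnit_det _).1 hunit), Matrix.one_mulVec]
  have hoff : ∀ j ∉ T, dualCoef a T c j = 0 := fun j hj => by
    rw [← maskedGram_mulVec_of_notMem a hj (dualCoef a T c), hmul]; simp [hj]
  refine ⟨hoff, fun k hk => ?_⟩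
  rw [← maskedGram_mulVec_of_mem a hk hoff, hmul]
  simp [hk]

theorem dualCoef_congr {a b : Fin N → H} {T : Finset (Fin N)} (h : ∀ j ∈ T, a j = b j)
    (c : Fin N → ℝ) : dualCoef a T c = dualCoef b T c := by
  have : maskedGram a T = maskedGram b T := by
    ext j k
    simp only [maskedGram, Matrix.of_apply]
    split_ifs with h1
    · rw [h j h1.1, h k h1.2]
    · rfl
    · rfl
  rw [dualCoef, dualCoef, this]

theorem eq_zero_of_gram_lower {a : Fin N → H} {T : Finset (Fin N)} {κ : ℝ} (hκ : 0 < κ)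
    (hG : ∀ z : Fin N → ℝ, (∀ j ∉ T, z j = 0) → κ * ∑ j, z j ^ 2 ≤ ‖colComb a z‖ ^ 2)
    (z : Fin N → ℝ) (hz : ∀ j ∉ T, z j = 0) (h0 : colComb a z = 0) : z = 0 := by
  have h := hG z hz
  rw [h0, norm_zero] at h
  have h1 : ∑ j, z j ^ 2 = 0 :=
    le_antisymm (by nlinarith) (Finset.sum_nonneg fun j _ => sq_nonneg _)
  rw [Finset.sum_eq_zero_iff_of_nonneg fun j _ => sq_nonneg _] at h1
  ext j
  simpa using h1 j (Finset.mem_univ j)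

theorem sq_le_sum_sq (z : Fin N → ℝ) (i : Fin N) : z i ^ 2 ≤ ∑ j, z j ^ 2 :=
  Finset.single_le_sum (f := fun j => z j ^ 2) (fun _ _ => sq_nonneg _) (Finset.mem_univ i)

theorem norm_sq_colComb_eq {a : Fin N → H} {T : Finset (Fin N)} {z c : Fin N → ℝ}
    (hz : ∀ j ∉ T, z j = 0) (hc : ∀ k ∈ T, inner ℝ (a k) (colComb a z) = c k) :
    ‖colComb a z‖ ^ 2 = ∑ k ∈ T, z k * c k := by
  rw [← real_inner_self_eq_norm_sq, inner_colComb,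
    ← Finset.sum_subset (Finset.subset_univ T) fun j _ hj => by rw [hz j hj, zero_mul]]
  exact Finset.sum_congr rfl fun k hk => by rw [hc k hk]

/-- The dual vector attached to signs `σ` has squared norm at most `|T| / κ`. -/
theorem norm_sq_dual_le {a : Fin N → H} {T : Finset (Fin N)} {κ : ℝ} (hκ : 0 < κ)
    (hG : ∀ z : Fin N → ℝ, (∀ j ∉ T, z j = 0) → κ * ∑ j, z j ^ 2 ≤ ‖colComb a z‖ ^ 2)
    {σ : Fin N → ℝ} (hσ : ∀ j, |σ j| ≤ 1) :
    κ * ‖colComb a (dualCoef a T σ)‖ ^ 2 ≤ T.card := by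
  obtain ⟨hoff, hon⟩ := dualCoef_spec (eq_zero_of_gram_lower hκ hG) σ
  set z := dualCoef a T σ
  have h1 := norm_sq_colComb_eq hoff hon
  have h2 := hG z hoff
  have h3 : ∑ j, z j ^ 2 = ∑ j ∈ T, z j ^ 2 :=
    (Finset.sum_subset (Finset.subset_univ T) fun j _ hj => by rw [hoff j hj]; simp).symm
  have h4 : 2 * κ * ∑ k ∈ T, z k * σ k ≤ κ ^ 2 * ∑ j ∈ T, z j ^ 2 + T.card := by
    rw [Finset.mul_sum, Finset.mul_sum, ← nsmul_one T.card, ← Finset.sum_const,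
      ← Finset.sum_add_distrib]
    refine Finset.sum_le_sum fun k _ => ?_
    have := sq_le_one_iff_abs_le_one (σ k) |>.2 (hσ k)
    nlinarith [sq_nonneg (κ * z k - σ k)]
  rw [h3] at h2
  nlinarith

theorem coef_abs_le {a : Fin N → H} {S : Finset (Fin N)} {κ : ℝ}
    (hG : ∀ z : Fin N → ℝ, (∀ j ∉ S, z j = 0) → κ * ∑ j, z j ^ 2 ≤ ‖colComb a z‖ ^ 2)
    {σ w z : Fin N → ℝ} {i : Fin N} (hi : i ∈ S) (hκ : 0 < κ)
    (hw : ∀ j ∉ S, w j = 0) (hwS : ∀ k ∈ S, inner ℝ (a k) (colComb a w) = σ k)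
    (hz : ∀ j ∉ S.erase i, z j = 0)
    (hzS : ∀ k ∈ S.erase i, inner ℝ (a k) (colComb a z) = σ k) :
    κ * |w i| ≤ |σ i - inner ℝ (a i) (colComb a z)| := by
  have hq : ∀ j ∉ S, (w - z) j = 0 := fun j hj => by
    rw [Pi.sub_apply, hw j hj, hz j fun h => hj (Finset.mem_of_mem_erase h), sub_zero]
  have hzi : z i = 0 := hz i (Finset.notMem_erase i S)
  have hn : ‖colComb a (w - z)‖ ^ 2 = w i * (σ i - inner ℝ (a i) (colComb a z)) := by
    rw [← real_inner_self_eq_norm_sq, inner_colComb, Finset.sum_eq_single i]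
    · rw [map_sub, inner_sub_right, hwS i hi, Pi.sub_apply, hzi, sub_zero]
    · intro k _ hk
      by_cases hkS : k ∈ S
      · rw [map_sub, inner_sub_right, hwS k hkS, hzS k (Finset.mem_erase.2 ⟨hk, hkS⟩), sub_self,
          mul_zero]
      · rw [hq k hkS, zero_mul]
    · simp
  have h1 := hG _ hq
  have h2 := sq_le_sum_sq (w - z) i
  rw [hn] at h1
  rw [Pi.sub_apply, hzi, sub_zero] at h2
  have h3 := le_abs_self (w i * (σ i - inner ℝ (a i) (colComb a z)))
  rw [abs_mul] at h3
  rcases eq_or_ne (w i) 0 with h0 | h0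
  · rw [h0]; simp
  · have h4 : |w i| * (κ * |w i|) ≤ |w i| * |σ i - inner ℝ (a i) (colComb a z)| := by
      nlinarith [sq_abs (w i)]
    exact le_of_mul_le_mul_left h4 (abs_pos.2 h0)

end Deterministic

section Perturbation

variable {H : Type*} [NormedAddCommGroup H] [InnerProductSpace ℝ H] {N : ℕ}

theorem colComb_sub_left (a b : Fin N → H) (x : Fin N → ℝ) :
    colComb (a - b) x = colComb a x - colComb b x := by
  simp [Fintype.linearCombination_apply, smul_sub, Finset.sum_sub_distrib]

theorem sign_mul_eq_abs_of_abs_sub_lt {x v : ℝ} (h : |x - v| < |v|) : Real.sign v * x = |x| := by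
  rcases lt_trichotomy v 0 with hv | hv | hv
  · rw [abs_of_neg hv, abs_lt] at h
    rw [Real.sign_of_neg hv, abs_of_neg (by linarith [h.2])]; ring
  · rw [hv, abs_zero] at h
    exact absurd h (not_lt.2 (abs_nonneg _))
  · rw [abs_of_pos hv, abs_lt] at h
    rw [Real.sign_of_pos hv, abs_of_pos (by linarith [h.1])]; ring

theorem ne_zero_of_abs_sub_lt {x v : ℝ} (h : |x - v| < |v|) : x ≠ 0 := by
  rintro rfl
  rw [zero_sub, abs_neg] at h
  exact lt_irrefl _ h

theorem abs_sign_le_one (x : ℝ) : |Real.sign x| ≤ 1 := by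
  rcases Real.sign_apply_eq x with h | h | h <;> rw [h] <;> norm_num

/-- A lower bound on the Gram form survives small perturbations of the columns. -/
theorem gram_lower_of_perturb {a b : Fin N → H} {η κ : ℝ} {z : Fin N → ℝ}
    (hba : ∀ j, ‖b j - a j‖ ≤ η) (hκ : 1 / 2 ≤ κ) (hη : 24 * (η ^ 2 * N) ≤ 1)
    (hG : κ * ∑ j, z j ^ 2 ≤ ‖colComb a z‖ ^ 2) :
    1 / 4 * ∑ j, z j ^ 2 ≤ ‖colComb b z‖ ^ 2 := by
  have hZ : 0 ≤ ∑ j, z j ^ 2 := Finset.sum_nonneg fun j _ => sq_nonneg _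
  have h1 : ‖colComb (b - a) z‖ ≤ η * ∑ j, |z j| := norm_colComb_le hba z
  have h2 : ‖colComb (b - a) z‖ ^ 2 ≤ η ^ 2 * (N * ∑ j, z j ^ 2) := by
    refine (pow_le_pow_left₀ (norm_nonneg _) h1 2).trans ?_
    rw [mul_pow]
    exact mul_le_mul_of_nonneg_left (sum_abs_sq_le z) (sq_nonneg _)
  have h3 : ‖colComb a z‖ ≤ ‖colComb b z‖ + ‖colComb (b - a) z‖ := by
    have : colComb a z = colComb b z - colComb (b - a) z := by rw [colComb_sub_left]; abel
    rw [this]; exact norm_sub_le _ _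
  have h4 : ‖colComb a z‖ ^ 2 ≤ 3 / 2 * ‖colComb b z‖ ^ 2 + 3 * ‖colComb (b - a) z‖ ^ 2 := by
    nlinarith [norm_nonneg (colComb a z), sq_nonneg (‖colComb b z‖ - 2 * ‖colComb (b - a) z‖)]
  nlinarith

set_option maxHeartbeats 1000000 in
/-- If the columns `a` satisfy a Gram lower bound on the support `S` of `v` and a leave-one-out
dual certificate, then every sufficiently small perturbation of the LASSO problem for
`(colComb a v, a)` has a unique minimiser, and its support is `S`. -/
theorem exists_unique_min_of_perturb {a b : Fin N → H} {S : Finset (Fin N)} {v : Fin N → ℝ}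
    {y : H} {η lam M V : ℝ} (hS : ∀ j, j ∈ S ↔ v j ≠ 0) (hSne : S.Nonempty)
    (hV : 1 ≤ V) (hvV : ∀ j, |v j| ≤ V) (hM : 1 ≤ M) (hMN : M ≤ N) (hN : (4 : ℝ) ≤ N)
    (hSM : 4 * (S.card : ℝ) ≤ M) (hη : 0 ≤ η)
    (hG : ∀ z : Fin N → ℝ, (∀ j ∉ S, z j = 0) → M / 2 * ∑ j, z j ^ 2 ≤ ‖colComb a z‖ ^ 2)
    (hD : ∀ j, |inner ℝ (a j)
      (colComb a (dualCoef a (S.erase j) fun k => Real.sign (v k)))| ≤ 3 / 4)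
    (ha : ∀ j, ‖a j‖ ≤ (N : ℝ) ^ 2) (hba : ∀ j, ‖b j - a j‖ ≤ η) (hy : ‖y - colComb a v‖ ≤ η)
    (hsmall : 100 * (η * N ^ 6 * V) ≤ 1) (hlam : 2 / (N : ℝ) ^ 2 ≤ lam)
    (hlamv : ∀ j ∈ S, 4 * lam < 2 * M * |v j| - 1 / (N : ℝ) ^ 2) :
    ∃ x : Fin N → ℝ, (∀ j, x j ≠ 0 ↔ j ∈ S) ∧ ∀ z, z ≠ x →
      ‖colComb b x - y‖ ^ 2 + lam * ∑ j, |x j| < ‖colComb b z - y‖ ^ 2 + lam * ∑ j, |z j| := by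
  set K : ℝ := (N : ℝ) with hK
  set σ : Fin N → ℝ := fun k => Real.sign (v k) with hσdef
  have hK0 : 0 < K := by linarith
  have hM0 : 0 < M / 2 := by linarith
  have hq0 : 0 < 1 / K ^ 2 := by positivity
  have hlam' : 2 * (1 / K ^ 2) ≤ lam := by rw [← mul_div_assoc, mul_one]; exact hlam
  have hlam0 : 0 < lam := by linarith
  have hV0 : 0 < V := by linarith
  -- scalar bookkeeping
  set P : ℝ := η * K ^ 4 * V with hP
  have hP0 : 0 ≤ P := by positivity
  have hPq : 100 * P ≤ 1 / K ^ 2 := by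
    rw [le_div_iff₀ (by positivity)]
    calc 100 * P * K ^ 2 = 100 * (η * K ^ 6 * V) := by rw [hP]; ring
      _ ≤ 1 := hsmall
  have hstep : ∀ t : ℝ, 0 ≤ t → 4 * t ≤ K * t := fun t ht => mul_le_mul_of_nonneg_right hN ht
  have hP3 : 4 * (η * K ^ 3 * V) ≤ P := by
    have := hstep (η * K ^ 3 * V) (by positivity)
    rw [hP]; linarith
  have hP2 : 4 * (η * K ^ 2 * V) ≤ η * K ^ 3 * V := by
    have := hstep (η * K ^ 2 * V) (by positivity)
    linarith
  have hP1 : 4 * (η * K * V) ≤ η * K ^ 2 * V := by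
    have := hstep (η * K * V) (by positivity)
    linarith
  have hqle : 1 / K ^ 2 ≤ 1 / 16 := by
    apply one_div_le_one_div_of_le (by norm_num); nlinarith
  have hKV1 : 1 ≤ K * V := by nlinarith
  have hηKV : η ≤ η * K * V := by nlinarith
  have hη1 : η * K ≤ 1 / 1000 := by
    have : η * K ≤ η * K * V := le_mul_of_one_le_right (by positivity) hV
    linarith
  have hη2 : η ≤ 1 := by linarith [hηKV]
  have hηsq : 24 * (η ^ 2 * N) ≤ 1 := by
    have : η ^ 2 * K ≤ 1 * (η * K) := by nlinarith [mul_nonneg hη hK0.le]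
    linarith
  -- the Gram bounds
  have hinj := eq_zero_of_gram_lower hM0 hG
  have hG' : ∀ z : Fin N → ℝ, (∀ j ∉ S, z j = 0) →
      1 / 4 * ∑ j, z j ^ 2 ≤ ‖colComb b z‖ ^ 2 := fun z hz =>
    gram_lower_of_perturb hba (by linarith) hηsq (hG z hz)
  have hinj' := eq_zero_of_gram_lower (by norm_num) hG'
  have hSK : 4 * (S.card : ℝ) ≤ K := hSM.trans hMN
  -- the unperturbed dual vector
  obtain ⟨hwoff, hwon⟩ := dualCoef_spec hinj σ
  set w := dualCoef a S σ with hw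
  have hσ1 : ∀ j, |σ j| ≤ 1 := fun j => abs_sign_le_one _
  have hwi : ∀ i ∈ S, M * |w i| ≤ 7 / 2 := by
    intro i hi
    have hGe : ∀ z : Fin N → ℝ, (∀ j ∉ S.erase i, z j = 0) →
        M / 2 * ∑ j, z j ^ 2 ≤ ‖colComb a z‖ ^ 2 := fun z hz =>
      hG z fun j hj => hz j fun h => hj (Finset.mem_of_mem_erase h)
    obtain ⟨hzoff, hzon⟩ := dualCoef_spec (eq_zero_of_gram_lower hM0 hGe) σ
    have h1 := coef_abs_le hG hi hM0 hwoff hwon hzoff hzon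
    have h2 := abs_sub (σ i) (inner ℝ (a i) (colComb a (dualCoef a (S.erase i) σ)))
    linarith [hD i, hσ1 i]
  have hcw : ‖colComb a w‖ ≤ 1 := by
    have h1 := norm_sq_dual_le hM0 hG hσ1
    rw [← hw] at h1
    by_contra! hcon
    have h2 : 1 < ‖colComb a w‖ ^ 2 := one_lt_pow₀ hcon two_ne_zero
    nlinarith
  have hlamKV : 2 * lam ≤ K * V := by
    obtain ⟨j, hj⟩ := hSne
    have h1 := hlamv j hj
    have h2 : M * |v j| ≤ K * V := mul_le_mul hMN (hvV j) (abs_nonneg _) hK0.le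
    linarith
  set r0 : H := (lam / 2) • colComb a w with hr0
  have hr0n : ‖r0‖ ≤ K * V / 4 := by
    rw [hr0, norm_smul, Real.norm_eq_abs, abs_of_pos (by linarith)]
    nlinarith [norm_nonneg (colComb a w)]
  set x0 : Fin N → ℝ := v - (lam / 2) • w with hx0
  have hvoff : ∀ j ∉ S, v j = 0 := fun j hj => by
    by_contra h; exact hj ((hS j).2 h)
  have hx0off : ∀ j ∉ S, x0 j = 0 := fun j hj => by
    simp [hx0, hvoff j hj, hwoff j hj]
  have hdev : ∀ j ∈ S, M * |lam / 2 * w j| ≤ 7 / 4 * lam := fun j hj => by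
    rw [abs_mul, abs_of_pos (by linarith : (0 : ℝ) < lam / 2)]
    nlinarith [hwi j hj]
  have hx0sum : ∑ j, |x0 j| ≤ K * V / 2 := by
    rw [← Finset.sum_subset (Finset.subset_univ S) fun j _ hj => by rw [hx0off j hj, abs_zero]]
    have h1 : ∀ j ∈ S, |x0 j| ≤ 2 * V := fun j hj => by
      have h2 : |x0 j| ≤ |v j| + |lam / 2 * w j| := abs_sub _ _
      have h3 : |lam / 2 * w j| ≤ |v j| := by
        refine le_of_mul_le_mul_left ?_ (by linarith : 0 < M)
        linarith [hdev j hj, hlamv j hj]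
      linarith [hvV j]
    refine (Finset.sum_le_card_nsmul S _ _ h1).trans ?_
    rw [nsmul_eq_mul]
    nlinarith
  have hax0 : colComb a x0 = colComb a v - r0 := by rw [hx0, map_sub, map_smul]
  set ρ : H := (y - colComb a v) - colComb (b - a) x0 with hρ
  have hbx0 : y - colComb b x0 = r0 + ρ := by
    rw [hρ, colComb_sub_left, hax0]; abel
  have hρn : ‖ρ‖ ≤ 2 * (η * K * V) := by
    have h1 : ‖colComb (b - a) x0‖ ≤ η * ∑ j, |x0 j| := norm_colComb_le hba x0
    have h2 := mul_le_mul_of_nonneg_left hx0sum hη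
    have h3 := norm_sub_le (y - colComb a v) (colComb (b - a) x0)
    rw [← hρ] at h3
    nlinarith
  -- the correction of the minimiser
  set c : Fin N → ℝ := fun k => inner ℝ ((b - a) k) r0 + inner ℝ (b k) ρ with hc
  obtain ⟨hgoff, hgon⟩ := dualCoef_spec hinj' c
  set g := dualCoef b S c with hg
  set Q := ‖colComb b g‖ with hQ
  have hQ0 : 0 ≤ Q := norm_nonneg _
  have hgsq := hG' g hgoff
  have hgsum : ∑ j, |g j| ≤ K * Q := by
    refine (le_abs_self _).trans (abs_le_of_sq_le_sq ?_ (by positivity))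
    have h1 := mul_le_mul_of_nonneg_left (show ∑ j, g j ^ 2 ≤ 4 * Q ^ 2 by linarith) hK0.le
    have h2 := mul_le_mul_of_nonneg_left (hstep (Q ^ 2) (sq_nonneg _)) hK0.le
    calc (∑ j, |g j|) ^ 2 ≤ K * ∑ j, g j ^ 2 := sum_abs_sq_le g
      _ ≤ K * (K * Q ^ 2) := h1.trans h2
      _ = (K * Q) ^ 2 := by ring
  have hgi : ∀ i, |g i| ≤ 2 * Q := fun i => by
    refine abs_le_of_sq_le_sq ?_ (by positivity)
    nlinarith [sq_le_sum_sq g i]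
  have hQle : Q ≤ η * K ^ 2 * V := by
    have h1 : Q ^ 2 = inner ℝ (colComb (b - a) g) r0 + inner ℝ (colComb b g) ρ := by
      rw [hQ, norm_sq_colComb_eq hgoff hgon, inner_colComb, inner_colComb,
        ← Finset.sum_add_distrib]
      rw [Finset.sum_subset (Finset.subset_univ S) fun j _ hj => by rw [hgoff j hj, zero_mul]]
      exact Finset.sum_congr rfl fun k _ => by rw [hc]; ring
    have h2 : ‖colComb (b - a) g‖ ≤ η * (K * Q) :=
      (norm_colComb_le hba g).trans (mul_le_mul_of_nonneg_left hgsum hη)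
    have h3 : inner ℝ (colComb (b - a) g) r0 ≤ η * (K * Q) * (K * V / 4) :=
      (real_inner_le_norm _ _).trans (mul_le_mul h2 hr0n (norm_nonneg _) (by positivity))
    have h4 : inner ℝ (colComb b g) ρ ≤ Q * (2 * (η * K * V)) :=
      (real_inner_le_norm _ _).trans (mul_le_mul_of_nonneg_left hρn hQ0)
    have h5 : Q * Q ≤ Q * (η * K ^ 2 * V / 4 + 2 * (η * K * V)) := by nlinarith
    rcases hQ0.eq_or_lt with h0 | h0
    · rw [← h0]; positivity
    · have := le_of_mul_le_mul_left h5 h0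
      linarith
  -- the perturbed minimiser
  have hbn : ∀ j, ‖b j‖ ≤ 2 * K ^ 2 := fun j => by
    have h1 : ‖b j‖ ≤ ‖a j‖ + ‖b j - a j‖ := by
      have := norm_add_le (a j) (b j - a j); rwa [add_sub_cancel] at this
    nlinarith [ha j, hba j]
  set x := x0 + g with hx
  have hres : y - colComb b x = r0 + (ρ - colComb b g) := by
    rw [hx, map_add, ← sub_sub, hbx0]; abel
  have hxoff : ∀ j ∉ S, x j = 0 := fun j hj => by
    rw [hx, Pi.add_apply, hx0off j hj, hgoff j hj, add_zero]
  have hnear : ∀ j ∈ S, |x j - v j| < |v j| := fun j hj => by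
    have h1 : x j - v j = g j - lam / 2 * w j := by simp [hx, hx0]; ring
    have h2 := abs_sub (g j) (lam / 2 * w j)
    have h3 : M * |g j| ≤ 2 * (η * K ^ 3 * V) := by
      calc M * |g j| ≤ K * (2 * (η * K ^ 2 * V)) :=
            mul_le_mul hMN ((hgi j).trans (by linarith)) (abs_nonneg _) hK0.le
        _ = 2 * (η * K ^ 3 * V) := by ring
    rw [h1]
    refine lt_of_mul_lt_mul_left ?_ (by linarith : 0 ≤ M)
    have h4 := mul_le_mul_of_nonneg_left h2 (by linarith : 0 ≤ M)
    linarith [hdev j hj, hlamv j hj]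
  have hcorr : ∀ j ∈ S, inner ℝ (b j) (y - colComb b x) = lam / 2 * σ j := fun j hj => by
    have h1 : b j = a j + (b - a) j := by simp
    have h2 : inner ℝ (b j) r0 = lam / 2 * σ j + inner ℝ ((b - a) j) r0 := by
      conv_lhs => rw [h1, inner_add_left]
      rw [hr0, inner_smul_right, hwon j hj]
    rw [hres, inner_add_right, inner_sub_right, hgon j hj, h2, hc]
    ring
  have hcorr' : ∀ j ∉ S, |inner ℝ (b j) (y - colComb b x)| < lam / 2 := fun j hj => by
    have h1 : b j = a j + (b - a) j := by simp
    have h2 : inner ℝ (b j) (y - colComb b x) = lam / 2 * inner ℝ (a j) (colComb a w)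
        + inner ℝ ((b - a) j) r0 + inner ℝ (b j) (ρ - colComb b g) := by
      rw [hres, inner_add_right]
      congr 1
      conv_lhs => rw [h1, inner_add_left]
      rw [hr0, inner_smul_right (a j)]
    have h3 : |lam / 2 * inner ℝ (a j) (colComb a w)| ≤ lam / 2 * (3 / 4) := by
      rw [abs_mul, abs_of_pos (by linarith : (0 : ℝ) < lam / 2)]
      have := hD j
      rw [Finset.erase_eq_of_notMem hj] at this
      exact mul_le_mul_of_nonneg_left this (by linarith)
    have h4 : |inner ℝ ((b - a) j) r0| ≤ η * (K * V / 4) :=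
      (abs_real_inner_le_norm _ _).trans (mul_le_mul (hba j) hr0n (norm_nonneg _) hη)
    have h5 : |inner ℝ (b j) (ρ - colComb b g)|
        ≤ 2 * K ^ 2 * (2 * (η * K * V) + η * K ^ 2 * V) :=
      (abs_real_inner_le_norm _ _).trans (mul_le_mul (hbn j)
        ((norm_sub_le _ _).trans (add_le_add hρn hQle)) (norm_nonneg _) (by positivity))
    have h6 : 2 * K ^ 2 * (2 * (η * K * V) + η * K ^ 2 * V) = 4 * (η * K ^ 3 * V) + 2 * P := by
      rw [hP]; ring
    rw [h2]
    refine (abs_add_three _ _ _).trans_lt ?_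
    rw [h6] at h5
    linarith
  have hxz : ∀ j, x j = 0 → j ∉ S := fun j hj hjS =>
    ne_zero_of_abs_sub_lt (hnear j hjS) hj
  refine ⟨x, fun j => ⟨fun h => ?_, fun h => ne_zero_of_abs_sub_lt (hnear j h)⟩, fun z hz => ?_⟩
  · by_contra hj; exact h (hxoff j hj)
  refine lasso_lt_of_kkt (fun j => ?_) (fun j => ?_) (fun j hj => hcorr' j (hxz j hj))
    (fun u hu => hinj' u fun j hj => hu j (hxoff j hj)) hz
  · by_cases hj : j ∈ S
    · rw [hcorr j hj, abs_mul, abs_of_pos (by linarith : (0 : ℝ) < lam / 2)]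
      nlinarith [hσ1 j]
    · exact (hcorr' j hj).le
  · by_cases hj : j ∈ S
    · rw [hcorr j hj, mul_assoc, hσdef]
      dsimp only
      rw [sign_mul_eq_abs_of_abs_sub_lt (hnear j hj)]
    · rw [hxoff j hj, abs_zero, mul_zero, mul_zero]

end Perturbation

section Stability

variable {m N : ℕ}

/-- The columns of a matrix as vectors of Euclidean space. -/
def euclCol (A : Matrix (Fin m) (Fin N) ℝ) (j : Fin N) : EuclideanSpace ℝ (Fin m) :=
  WithLp.toLp 2 fun i => A i j

theorem colComb_euclCol (A : Matrix (Fin m) (Fin N) ℝ) (x : Fin N → ℝ) :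
    colComb (euclCol A) x = WithLp.toLp 2 (A.mulVec x) := by
  ext i
  simp [Fintype.linearCombination_apply, euclCol, Matrix.mulVec, dotProduct, mul_comm]

theorem lassoObj_eq (lam : ℝ) (y : Fin m → ℝ) (A : Matrix (Fin m) (Fin N) ℝ) (x : Fin N → ℝ) :
    lassoObj lam y A x
      = ‖colComb (euclCol A) x - WithLp.toLp 2 y‖ ^ 2 + lam * ∑ j, |x j| := by
  rw [lassoObj, colComb_euclCol, EuclideanSpace.real_norm_sq_eq]
  rfl

theorem norm_toLp_le {w : Fin m → ℝ} {δ : ℝ} (hw : ∀ i, |w i| ≤ δ) (hδ : 0 ≤ δ) (hmN : m ≤ N) :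
    ‖(WithLp.toLp 2 w : EuclideanSpace ℝ (Fin m))‖ ≤ N * δ := by
  refine abs_le_of_sq_le_sq' ?_ (by positivity) |>.2
  rw [EuclideanSpace.real_norm_sq_eq]
  have h1 : ∑ i, w i ^ 2 ≤ ∑ _i : Fin m, δ ^ 2 :=
    Finset.sum_le_sum fun i _ => sq_le_sq' (abs_le.1 (hw i)).1 (abs_le.1 (hw i)).2
  rw [Finset.sum_const, Finset.card_univ, Fintype.card_fin, nsmul_eq_mul] at h1
  refine h1.trans ?_
  rw [mul_pow]
  refine mul_le_mul_of_nonneg_right ?_ (sq_nonneg _)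
  have : m ≤ N ^ 2 := hmN.trans (Nat.le_self_pow two_ne_zero N)
  exact_mod_cast this

theorem mem_suppF {v : Fin N → ℝ} {j : Fin N} : j ∈ suppF v ↔ v j ≠ 0 := by
  simp [suppF]

theorem minAbsOn_le {v : Fin N → ℝ} {j : Fin N} (hj : v j ≠ 0) : minAbsOn v ≤ |v j| :=
  csInf_le ⟨0, by rintro r ⟨k, -, rfl⟩; exact abs_nonneg _⟩ ⟨j, hj, rfl⟩

theorem abs_le_l2norm (v : Fin N → ℝ) (j : Fin N) : |v j| ≤ l2norm v :=
  Real.abs_le_sqrt (sq_le_sum_sq v j)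

/-- Support recovery and stability of the LASSO from a Gram lower bound on the support of `v`
and a leave-one-out dual certificate. -/
theorem condUL_lt_and_recovery {A : Matrix (Fin m) (Fin N) ℝ} {v : Fin N → ℝ} {lam : ℝ}
    (hne : (suppF v).Nonempty) (hm : 1 ≤ m) (hmN : m ≤ N) (hN : 4 ≤ N)
    (hSm : 4 * (suppF v).card ≤ m)
    (hG : ∀ z : Fin N → ℝ, (∀ j ∉ suppF v, z j = 0) →
      (m : ℝ) / 2 * ∑ j, z j ^ 2 ≤ ‖colComb (euclCol A) z‖ ^ 2)
    (hD : ∀ j, |inner ℝ (euclCol A j) (colComb (euclCol A)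
      (dualCoef (euclCol A) ((suppF v).erase j) fun k => Real.sign (v k)))| ≤ 3 / 4)
    (hA : ∀ j, ‖euclCol A j‖ ≤ (N : ℝ) ^ 2) (hlam : 2 / (N : ℝ) ^ 2 ≤ lam)
    (hlamv : 4 * lam < 2 * (m : ℝ) * minAbsOn v - 1 / (N : ℝ) ^ 2) :
    condUL lam (A.mulVec v) A
        < ENNReal.ofReal (542062 * (N : ℝ) ^ (7.5 : ℝ) * (max 1 (l2norm v)) ^ 5) ∧
      ∃ x : Fin N → ℝ, Sol lam (A.mulVec v) A = {x} ∧ supp x = supp v := by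
  set V := max 1 (l2norm v) with hV
  have hV1 : 1 ≤ V := le_max_left _ _
  have hNR : (4 : ℝ) ≤ N := by exact_mod_cast hN
  have hN0 : (0 : ℝ) < N := by linarith
  set δ₀ : ℝ := 1 / (100 * (N : ℝ) ^ 7 * V) with hδ₀
  have hδ₀pos : 0 < δ₀ := by positivity
  have hpert : ∀ δ : ℝ, 0 ≤ δ → δ ≤ δ₀ → ∀ (y' : Fin m → ℝ) (A' : Matrix (Fin m) (Fin N) ℝ),
      (∀ i, |y' i - A.mulVec v i| ≤ δ) → (∀ i j, |A' i j - A i j| ≤ δ) →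
      ∃ x, Sol lam y' A' = {x} ∧ supp x = supp v := by
    intro δ hδ0 hδ y' A' hy' hA'
    have hcol : ∀ j, ‖euclCol A' j - euclCol A j‖ ≤ N * δ := fun j =>
      norm_toLp_le (w := fun i => A' i j - A i j) (fun i => hA' i j) hδ0 hmN
    have hy : ‖(WithLp.toLp 2 y' : EuclideanSpace ℝ (Fin m)) - colComb (euclCol A) v‖
        ≤ N * δ := by
      rw [colComb_euclCol]
      exact norm_toLp_le (w := fun i => y' i - A.mulVec v i) hy' hδ0 hmN
    have hsmall : 100 * ((N : ℝ) * δ * (N : ℝ) ^ 6 * V) ≤ 1 := by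
      calc 100 * ((N : ℝ) * δ * (N : ℝ) ^ 6 * V) = δ * (100 * (N : ℝ) ^ 7 * V) := by ring
        _ ≤ δ₀ * (100 * (N : ℝ) ^ 7 * V) := mul_le_mul_of_nonneg_right hδ (by positivity)
        _ = 1 := by rw [hδ₀]; field_simp
    obtain ⟨x, hxs, hx⟩ := exists_unique_min_of_perturb (M := (m : ℝ)) (fun j => mem_suppF) hne hV1
      (fun j => (abs_le_l2norm v j).trans (le_max_right _ _)) (by exact_mod_cast hm)
      (by exact_mod_cast hmN) hNR (by exact_mod_cast hSm) (by positivity) hG hD hA hcol hy hsmall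
      hlam (fun j hj => hlamv.trans_le (by
        have := mul_le_mul_of_nonneg_left (minAbsOn_le (mem_suppF.1 hj))
          (by positivity : (0 : ℝ) ≤ 2 * m)
        linarith))
    simp only [← lassoObj_eq] at hx
    refine ⟨x, ?_, ?_⟩
    · ext z
      rw [Set.mem_singleton_iff]
      constructor
      · intro hz
        by_contra hne
        exact absurd (hz x) (not_le.2 (hx z hne))
      · rintro rfl z'
        rcases eq_or_ne z' z with rfl | h
        · exact le_rfl
        · exact (hx z' h).le
    · ext j
      exact (hxs j).trans mem_suppF
  obtain ⟨x, hxSol, hxs⟩ := hpert 0 le_rfl hδ₀pos.le (A.mulVec v) A (by simp) (by simp)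
  refine ⟨?_, x, hxSol, hxs⟩
  have hst : δ₀ ≤ stsp lam (A.mulVec v) A := by
    refine le_csInf ?_ ?_
    · refine ⟨max 0 (∑ i, |A.mulVec v i|), le_max_left _ _, 0, A, x, 0, by rw [hxSol]; rfl, ?_,
        fun i => ?_, by simp, ?_⟩
      · intro z
        have h1 : lassoObj lam 0 A 0 = 0 := by simp [lassoObj]
        have hlam0 : 0 ≤ lam := le_trans (by positivity) hlam
        rw [h1, lassoObj]
        exact add_nonneg (Finset.sum_nonneg fun i _ => sq_nonneg _)
          (mul_nonneg hlam0 (Finset.sum_nonneg fun j _ => abs_nonneg _))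
      · rw [Pi.zero_apply, zero_sub, abs_neg]
        exact le_max_of_le_right (Finset.single_le_sum (f := fun i => |A.mulVec v i|)
          (fun i _ => abs_nonneg _) (Finset.mem_univ i))
      · obtain ⟨j, hj⟩ := hne
        intro h
        have : j ∈ supp x := by rw [hxs]; exact mem_suppF.1 hj
        rw [h] at this
        exact this rfl
    · rintro δ ⟨hδ0, y', A', x₁, x', hx₁, hx', hy', hA', hne'⟩
      by_contra! hlt
      obtain ⟨z, hz, hzs⟩ := hpert δ hδ0 hlt.le y' A' hy' hA'
      rw [hxSol, Set.mem_singleton_iff] at hx₁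
      rw [hz, Set.mem_singleton_iff] at hx'
      rw [hx₁, hx', hxs, hzs] at hne'
      exact hne' rfl
  have hst0 := hδ₀pos.trans_le hst
  rw [condUL, if_neg hst0.ne']
  have hpow : (N : ℝ) ^ 7 ≤ (N : ℝ) ^ (7.5 : ℝ) := by
    rw [← Real.rpow_natCast]
    exact Real.rpow_le_rpow_of_exponent_le (by linarith) (by norm_num)
  have hVV : V ≤ V ^ 5 := le_self_pow₀ hV1 (by norm_num)
  have hle : 1 / stsp lam (A.mulVec v) A ≤ 100 * (N : ℝ) ^ 7 * V := by
    calc 1 / stsp lam (A.mulVec v) A ≤ 1 / δ₀ := one_div_le_one_div_of_le hδ₀pos hst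
      _ = 100 * (N : ℝ) ^ 7 * V := by rw [hδ₀, one_div_one_div]
  have hpos : 0 < (N : ℝ) ^ 7 * V := by positivity
  have hmono : (N : ℝ) ^ 7 * V ≤ (N : ℝ) ^ (7.5 : ℝ) * V ^ 5 :=
    mul_le_mul hpow hVV (by linarith) (by positivity)
  refine (ENNReal.ofReal_lt_ofReal_iff (by positivity)).2 ?_
  nlinarith

end Stability

section Net

/-- The operator norm is controlled on a net of the ball of radius two. -/
theorem opNorm_le_of_net {E F : Type*} [NormedAddCommGroup E] [NormedSpace ℝ E]
    [NormedAddCommGroup F] [NormedSpace ℝ F] {D : Finset E}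
    (hD : ∀ x : E, ‖x‖ ≤ 2 → ∃ c ∈ D, ‖x - c‖ ≤ 1) {T : E →L[ℝ] F} {β : ℝ} (hβ : 0 ≤ β)
    (hT : ∀ c ∈ D, ‖T c‖ ≤ β) : ‖T‖ ≤ β := by
  have hball : ∀ x : E, ‖x‖ ≤ 2 → ‖T x‖ ≤ β + ‖T‖ := by
    intro x hx
    obtain ⟨c, hc, hxc⟩ := hD x hx
    have h1 : T x = T c + T (x - c) := by rw [map_sub]; abel
    rw [h1]
    refine (norm_add_le _ _).trans (add_le_add (hT c hc) ((T.le_opNorm _).trans ?_))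
    exact mul_le_of_le_one_right (norm_nonneg _) hxc
  have hmain : ‖T‖ ≤ (β + ‖T‖) / 2 := by
    refine T.opNorm_le_bound (by positivity) fun x => ?_
    rcases eq_or_ne x 0 with rfl | hx
    · simp
    have hx0 : 0 < ‖x‖ := norm_pos_iff.2 hx
    have h2 := hball ((2 / ‖x‖) • x) (by
      rw [norm_smul, Real.norm_eq_abs, abs_of_pos (by positivity), div_mul_cancel₀ _ hx0.ne'])
    rw [map_smul, norm_smul, Real.norm_eq_abs, abs_of_pos (by positivity), div_mul_eq_mul_div,
      div_le_iff₀ hx0] at h2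
    linarith
  linarith

variable {E F : Type*} [NormedAddCommGroup E] [InnerProductSpace ℝ E] [FiniteDimensional ℝ E]
  [NormedAddCommGroup F] [InnerProductSpace ℝ F] [FiniteDimensional ℝ F]

variable (E) in
theorem exists_one_net :
    ∃ D : Finset E, D.card ≤ 5 ^ Module.finrank ℝ E ∧ (∀ c ∈ D, ‖c‖ ≤ 2) ∧
      ∀ x : E, ‖x‖ ≤ 2 → ∃ c ∈ D, ‖x - c‖ ≤ 1 := by
  classical
  let P : ℕ → Prop := fun n => ∃ D : Finset E, D.card = n ∧ (∀ c ∈ D, ‖c‖ ≤ 2) ∧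
    ∀ c ∈ D, ∀ d ∈ D, c ≠ d → 1 ≤ ‖c - d‖
  have hbd : ∀ n, P n → n ≤ 5 ^ Module.finrank ℝ E := by
    rintro n ⟨D, rfl, h1, h2⟩
    exact Besicovitch.card_le_of_separated D h1 h2
  obtain ⟨D, hD, h1, h2⟩ := Nat.findGreatest_spec (P := P) (Nat.zero_le (5 ^ Module.finrank ℝ E))
    ⟨∅, by simp⟩
  refine ⟨D, hbd _ ⟨D, rfl, h1, h2⟩, h1, fun x hx => ?_⟩
  by_contra! hfar
  have hxD : x ∉ D := fun h => by
    have := hfar x h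
    rw [sub_self, norm_zero] at this
    linarith
  have hP : P (D.card + 1) := by
    refine ⟨insert x D, Finset.card_insert_of_notMem hxD, ?_, ?_⟩
    · intro c hc
      rcases Finset.mem_insert.1 hc with rfl | h
      exacts [hx, h1 c h]
    · intro c hc d hd hcd
      rcases Finset.mem_insert.1 hc with rfl | h <;> rcases Finset.mem_insert.1 hd with rfl | h'
      · exact absurd rfl hcd
      · exact (hfar d h').le
      · rw [norm_sub_rev]; exact (hfar c h).le
      · exact h2 c h d h' hcd
  have := Nat.le_findGreatest (hbd _ hP) hP
  omega

variable (E F) in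
/-- A finite set on which a two-sided Gram bound has to be tested to obtain a lower bound
everywhere. -/
theorem exists_gram_test :
    ∃ Z : Finset E, Z.card ≤ 2 * 25 ^ Module.finrank ℝ E ∧ ∀ (L : E →L[ℝ] F) (M : ℝ), 0 ≤ M →
      (∀ z ∈ Z, |‖L z‖ ^ 2 - M * ‖z‖ ^ 2| ≤ M / 8 * ‖z‖ ^ 2) →
      ∀ x, M / 2 * ‖x‖ ^ 2 ≤ ‖L x‖ ^ 2 := by
  classical
  obtain ⟨D, hcard, hD2, hD⟩ := exists_one_net E
  refine ⟨(D ×ˢ D).image (fun p => p.1 + p.2) ∪ (D ×ˢ D).image (fun p => p.1 - p.2), ?_, ?_⟩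
  · have h1 : (D ×ˢ D).card ≤ 25 ^ Module.finrank ℝ E := by
      rw [Finset.card_product]
      calc D.card * D.card ≤ 5 ^ Module.finrank ℝ E * 5 ^ Module.finrank ℝ E :=
            Nat.mul_le_mul hcard hcard
        _ = 25 ^ Module.finrank ℝ E := by rw [← mul_pow]; norm_num
    refine (Finset.card_union_le _ _).trans ?_
    have h2 := Finset.card_image_le (s := D ×ˢ D) (f := fun p => p.1 + p.2)
    have h3 := Finset.card_image_le (s := D ×ˢ D) (f := fun p => p.1 - p.2)
    omega
  · intro L M hM hZ x
    set T : E →L[ℝ] E := (ContinuousLinearMap.adjoint L).comp L - M • ContinuousLinearMap.id ℝ E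
      with hT
    have hTi : ∀ c d, inner ℝ (T c) d = inner ℝ (L c) (L d) - M * inner ℝ c d := fun c d => by
      simp [hT, inner_sub_left, ContinuousLinearMap.adjoint_inner_left, real_inner_smul_left]
    have hpol : ∀ c ∈ D, ∀ d ∈ D, |inner ℝ (T c) d| ≤ M / 2 := by
      intro c hc d hd
      have hp := abs_le.1 (hZ (c + d) (Finset.mem_union_left _ (Finset.mem_image.2
        ⟨(c, d), Finset.mk_mem_product hc hd, rfl⟩)))
      have hm := abs_le.1 (hZ (c - d) (Finset.mem_union_right _ (Finset.mem_image.2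
        ⟨(c, d), Finset.mk_mem_product hc hd, rfl⟩)))
      rw [map_add, norm_add_sq_real, norm_add_sq_real] at hp
      rw [map_sub, norm_sub_sq_real, norm_sub_sq_real] at hm
      have hc4 : ‖c‖ ^ 2 ≤ 4 := by nlinarith [hD2 c hc, norm_nonneg c]
      have hd4 : ‖d‖ ^ 2 ≤ 4 := by nlinarith [hD2 d hd, norm_nonneg d]
      have hc5 := mul_le_mul_of_nonneg_left hc4 hM
      have hd5 := mul_le_mul_of_nonneg_left hd4 hM
      rw [hTi, abs_le]
      constructor <;> linarith [hp.1, hp.2, hm.1, hm.2]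
    have hM2 : 0 ≤ M / 2 := by linarith
    have hTn : ‖T‖ ≤ M / 2 := by
      refine opNorm_le_of_net hD hM2 fun c hc => ?_
      rw [← innerSL_apply_norm (𝕜 := ℝ)]
      exact opNorm_le_of_net hD hM2 fun d hd => hpol c hc d hd
    have h1 : |inner ℝ (T x) x| ≤ M / 2 * ‖x‖ * ‖x‖ :=
      (abs_real_inner_le_norm _ _).trans (mul_le_mul_of_nonneg_right
        ((T.le_opNorm x).trans (mul_le_mul_of_nonneg_right hTn (norm_nonneg x))) (norm_nonneg x))
    rw [hTi, real_inner_self_eq_norm_sq, real_inner_self_eq_norm_sq] at h1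
    linarith [(abs_le.1 h1).1]

/-- Coordinate version of `exists_gram_test` for vectors supported on `S`. -/
theorem exists_gram_test_of_support (m : ℕ) {N : ℕ} (S : Finset (Fin N)) :
    ∃ Z : Finset (Fin N → ℝ), Z.card ≤ 2 * 25 ^ S.card ∧
      ∀ a : Fin N → EuclideanSpace ℝ (Fin m),
        (∀ z ∈ Z, |‖colComb a z‖ ^ 2 - m * ∑ j, z j ^ 2| ≤ m / 8 * ∑ j, z j ^ 2) →
        ∀ z : Fin N → ℝ, (∀ j ∉ S, z j = 0) →
          (m : ℝ) / 2 * ∑ j, z j ^ 2 ≤ ‖colComb a z‖ ^ 2 := by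
  classical
  let ext : EuclideanSpace ℝ S →ₗ[ℝ] (Fin N → ℝ) :=
    { toFun := fun x j => if h : j ∈ S then x ⟨j, h⟩ else 0
      map_add' := fun x y => by ext j; by_cases h : j ∈ S <;> simp [h]
      map_smul' := fun c x => by ext j; by_cases h : j ∈ S <;> simp [h] }
  have hext : ∀ x, ‖x‖ ^ 2 = ∑ j, ext x j ^ 2 := fun x => by
    rw [EuclideanSpace.real_norm_sq_eq,
      ← Finset.sum_subset (Finset.subset_univ S) fun j _ hj => by simp [ext, hj],
      ← Finset.sum_coe_sort S]
    exact Finset.sum_congr rfl fun j _ => by simp [ext]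
  obtain ⟨Z, hcard, hZ⟩ := exists_gram_test (EuclideanSpace ℝ S) (EuclideanSpace ℝ (Fin m))
  refine ⟨Z.image ext, Finset.card_image_le.trans (by simpa using hcard), fun a ha z hz => ?_⟩
  have h := hZ (LinearMap.toContinuousLinearMap (colComb a ∘ₗ ext)) m (Nat.cast_nonneg m)
    (fun x hx => by
      rw [hext]
      exact ha _ (Finset.mem_image_of_mem _ hx)) (WithLp.toLp 2 fun j => z j)
  have hz' : ext (WithLp.toLp 2 fun j => z j) = z := by
    ext j
    by_cases hj : j ∈ S
    · simp [ext, hj]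
    · simp [ext, hj, hz j hj]
  rw [hext] at h
  simpa [hz'] using h

end Net

section GaussianMatrix

variable {Ω : Type*} [MeasurableSpace Ω] {μ : Measure Ω} [IsProbabilityMeasure μ] {m N : ℕ}

theorem iIndepFun_rows {ι κ : Type*} [Fintype ι] [Fintype κ] {U : Ω → ι → κ → ℝ}
    (hU : Measurable U) (hind : iIndepFun (fun p : ι × κ => fun ω => U ω p.1 p.2) μ) :
    iIndepFun (fun i ω => U ω i) μ := by
  have hrow : ∀ i, Measurable fun ω => U ω i := fun i => by fun_prop
  have hent : ∀ p : ι × κ, Measurable fun ω => U ω p.1 p.2 := fun p => by fun_prop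
  have hprob : ∀ i j, IsProbabilityMeasure (μ.map fun ω => U ω i j) := fun i j =>
    Measure.isProbabilityMeasure_map (hent (i, j)).aemeasurable
  rw [iIndepFun_iff_map_fun_eq_infinitePi_map hrow]
  have h1 := (iIndepFun_iff_map_fun_eq_infinitePi_map hent).1 hind
  have h2 : ∀ i, μ.map (fun ω => U ω i)
      = Measure.infinitePi fun j => μ.map fun ω => U ω i j := fun i =>
    (iIndepFun_iff_map_fun_eq_infinitePi_map fun j => hent (i, j)).1
      (hind.precomp (g := fun j => (i, j)) fun j k h => by simpa using h)
  have h3 := Measure.infinitePi_map_curry (ι := ι) (κ := κ) fun i j => μ.map fun ω => U ω i j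
  rw [← h1, Measure.map_map (MeasurableEquiv.measurable _) (by fun_prop)] at h3
  simp only [h2]
  exact h3

theorem gram_test_tail {U : Ω → Fin m → Fin N → ℝ} (hU : Measurable U)
    (hind : iIndepFun (fun p : Fin m × Fin N => fun ω => U ω p.1 p.2) μ)
    (hlaw : ∀ i j, μ.map (fun ω => U ω i j) = gaussianReal 0 1) (z : Fin N → ℝ) :
    μ {ω | (m : ℝ) / 8 * ∑ j, z j ^ 2 <
        |‖colComb (euclCol (Matrix.of (U ω))) z‖ ^ 2 - m * ∑ j, z j ^ 2|}
      ≤ ENNReal.ofReal (2 * exp (-(m : ℝ) / 512)) := by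
  have hZ : 0 ≤ ∑ j, z j ^ 2 := Finset.sum_nonneg fun j _ => sq_nonneg _
  have hg : ∀ i, Measurable fun ω => ∑ j, z j * U ω i j := fun i => by fun_prop
  have hgl : ∀ i, μ.map (fun ω => ∑ j, z j * U ω i j)
      = gaussianReal 0 (∑ j, z j ^ 2).toNNReal := fun i =>
    map_sum_mul_gaussian (X := fun j ω => U ω i j) (fun j => by fun_prop)
      (hind.precomp (g := fun j => (i, j)) fun j k h => by simpa using h) (hlaw i) z Finset.univ
  have hgi : iIndepFun (fun i ω => ∑ j, z j * U ω i j) μ :=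
    (iIndepFun_rows hU hind).comp (fun _ (r : Fin N → ℝ) => ∑ j, z j * r j)
      fun _ => by fun_prop
  have h := sum_sq_gaussian_tail hg hgi hgl
  rw [Real.coe_toNNReal _ hZ] at h
  convert h using 6 with ω
  rw [colComb_euclCol, EuclideanSpace.real_norm_sq_eq]
  simp [Matrix.mulVec, dotProduct, mul_comm]

/-- A Gaussian vector tested against an independent random vector of small norm. -/
theorem inner_indep_tail {X W : Ω → Fin m → ℝ} (hX : ∀ i, Measurable fun ω => X ω i)
    (hXi : iIndepFun (fun i ω => X ω i) μ)
    (hXl : ∀ i, μ.map (fun ω => X ω i) = gaussianReal 0 1) (hW : Measurable W)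
    (hXW : IndepFun W X μ) {t r : ℝ} (ht : 0 ≤ t) (hr : 0 < r) :
    μ {ω | t < |∑ i, W ω i * X ω i| ∧ ∑ i, W ω i ^ 2 ≤ r}
      ≤ ENNReal.ofReal (2 * exp (-t ^ 2 / (2 * r))) := by
  have hXm : Measurable X := measurable_pi_iff.2 hX
  set B : Set ((Fin m → ℝ) × (Fin m → ℝ)) :=
    {p | t < |∑ i, p.1 i * p.2 i| ∧ ∑ i, p.1 i ^ 2 ≤ r} with hB
  have hB1 : MeasurableSet {p : (Fin m → ℝ) × (Fin m → ℝ) | t < |∑ i, p.1 i * p.2 i|} :=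
    measurableSet_lt measurable_const (by fun_prop)
  have hB2 : MeasurableSet {p : (Fin m → ℝ) × (Fin m → ℝ) | ∑ i, p.1 i ^ 2 ≤ r} :=
    measurableSet_le (by fun_prop) measurable_const
  have hBm : MeasurableSet B := hB1.inter hB2
  have h1 : μ {ω | t < |∑ i, W ω i * X ω i| ∧ ∑ i, W ω i ^ 2 ≤ r}
      = (μ.map fun ω => (W ω, X ω)) B := by
    rw [Measure.map_apply (hW.prodMk hXm) hBm]; rfl
  have : IsProbabilityMeasure (μ.map W) := Measure.isProbabilityMeasure_map hW.aemeasurable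
  have : IsProbabilityMeasure (μ.map X) := Measure.isProbabilityMeasure_map hXm.aemeasurable
  rw [h1, hXW.map_prod_eq_prod_map_map hW.aemeasurable hXm.aemeasurable, Measure.prod_apply hBm]
  have h2 : ∀ w, μ.map X (Prod.mk w ⁻¹' B) ≤ ENNReal.ofReal (2 * exp (-t ^ 2 / (2 * r))) := by
    intro w
    rw [Measure.map_apply hXm (measurable_prodMk_left hBm)]
    by_cases hw : ∑ i, w i ^ 2 ≤ r
    · refine (measure_mono ?_).trans (gaussianReal_abs_tail
        (map_sum_mul_gaussian hX hXi hXl w Finset.univ) ht hr ?_)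
      · intro ω hω
        exact hω.1
      · rw [Real.coe_toNNReal _ (Finset.sum_nonneg fun j _ => sq_nonneg _)]
        exact hw
    · have : X ⁻¹' (Prod.mk w ⁻¹' B) = ∅ := by
        ext ω
        simp [hB, hw]
      rw [this, measure_empty]
      exact zero_le
  calc ∫⁻ w, μ.map X (Prod.mk w ⁻¹' B) ∂(μ.map W)
      ≤ ∫⁻ _, ENNReal.ofReal (2 * exp (-t ^ 2 / (2 * r))) ∂(μ.map W) := lintegral_mono h2
    _ = ENNReal.ofReal (2 * exp (-t ^ 2 / (2 * r))) := by simp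

/-- The dual vector as a function of the matrix entries. -/
def dualVec (T : Finset (Fin N)) (c : Fin N → ℝ) (A : Fin m → Fin N → ℝ) : Fin m → ℝ :=
  (Matrix.of A).mulVec (dualCoef (euclCol (Matrix.of A)) T c)

theorem measurable_dualVec (T : Finset (Fin N)) (c : Fin N → ℝ) :
    Measurable (dualVec (m := m) T c) := by
  set G : (Fin m → Fin N → ℝ) → Matrix (Fin N) (Fin N) ℝ :=
    fun A => maskedGram (euclCol (Matrix.of A)) T with hGdef
  have hG : Continuous G := by
    refine continuous_matrix fun j k => ?_
    have : (fun A => G A j k) = fun A : Fin m → Fin N → ℝ =>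
        if j ∈ T ∧ k ∈ T then ∑ i, A i k * A i j else if j = k then 1 else 0 := by
      ext A
      simp [hGdef, maskedGram, euclCol, PiLp.inner_apply]
    rw [this]
    split_ifs <;> fun_prop
  have hdet : Measurable fun A => (G A).det := hG.matrix_det.measurable
  have hadj : ∀ j k, Measurable fun A => (G A).adjugate j k := fun j k =>
    (hG.matrix_adjugate.matrix_elem j k).measurable
  have hcoef : ∀ j, Measurable fun A : Fin m → Fin N → ℝ =>
      dualCoef (euclCol (Matrix.of A)) T c j := fun j => by
    have : (fun A : Fin m → Fin N → ℝ => dualCoef (euclCol (Matrix.of A)) T c j) = fun A =>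
        ∑ k, (G A).det⁻¹ * (G A).adjugate j k * if k ∈ T then c k else 0 := by
      ext A
      simp [dualCoef, Matrix.mulVec, dotProduct, Matrix.inv_def, hGdef]
    rw [this]
    refine Finset.measurable_sum _ fun k _ => ((hdet.inv).mul (hadj j k)).mul_const _
  refine measurable_pi_iff.2 fun i => ?_
  simp only [dualVec, Matrix.mulVec, dotProduct, Matrix.of_apply]
  refine Finset.measurable_sum _ fun j _ => ?_
  exact Measurable.mul (by fun_prop) (hcoef j)

/-- The matrix `A` with column `j` replaced by zero. -/
def zeroCol (j : Fin N) (A : Fin m → Fin N → ℝ) : Fin m → Fin N → ℝ :=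
  fun i k => if k = j then 0 else A i k

theorem indepFun_zeroCol {U : Ω → Fin m → Fin N → ℝ} (hU : Measurable U)
    (hind : iIndepFun (fun p : Fin m × Fin N => fun ω => U ω p.1 p.2) μ) (j : Fin N) :
    IndepFun (fun ω => zeroCol j (U ω)) (fun ω i => U ω i j) μ := by
  classical
  set T₁ : Finset (Fin m × Fin N) := Finset.univ.filter fun p => p.2 ≠ j with hT₁
  set T₂ : Finset (Fin m × Fin N) := Finset.univ.filter fun p => p.2 = j with hT₂
  have hdisj : Disjoint T₁ T₂ := Finset.disjoint_left.2 fun p hp hp' =>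
    (Finset.mem_filter.1 hp).2 (Finset.mem_filter.1 hp').2
  have h := hind.indepFun_finset T₁ T₂ hdisj fun p => by fun_prop
  let φ : (T₁ → ℝ) → Fin m → Fin N → ℝ := fun f i k =>
    if hk : k = j then 0 else f ⟨(i, k), by simpa [hT₁] using hk⟩
  let ψ : (T₂ → ℝ) → Fin m → ℝ := fun f i => f ⟨(i, j), by simp [hT₂]⟩
  have hφ : Measurable φ := by
    refine measurable_pi_iff.2 fun i => measurable_pi_iff.2 fun k => ?_
    by_cases hk : k = j
    · simp [φ, hk]
    · simp only [φ, hk, dite_false]; exact measurable_pi_apply _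
  have hψ : Measurable ψ := measurable_pi_iff.2 fun i => measurable_pi_apply _
  have h' := h.comp hφ hψ
  convert h' using 1
  · ext ω i k
    by_cases hk : k = j <;> simp [zeroCol, φ, hk]
  · rfl

theorem dual_cert_tail {U : Ω → Fin m → Fin N → ℝ} (hU : Measurable U)
    (hind : iIndepFun (fun p : Fin m × Fin N => fun ω => U ω p.1 p.2) μ)
    (hlaw : ∀ i j, μ.map (fun ω => U ω i j) = gaussianReal 0 1) (T : Finset (Fin N))
    (c : Fin N → ℝ) (j : Fin N) {t r : ℝ} (ht : 0 ≤ t) (hr : 0 < r) :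
    μ {ω | t < |∑ i, dualVec T c (zeroCol j (U ω)) i * U ω i j| ∧
        ∑ i, dualVec T c (zeroCol j (U ω)) i ^ 2 ≤ r}
      ≤ ENNReal.ofReal (2 * exp (-t ^ 2 / (2 * r))) := by
  have hz : Measurable fun ω => zeroCol j (U ω) := by
    refine measurable_pi_iff.2 fun i => measurable_pi_iff.2 fun k => ?_
    by_cases hk : k = j
    · simp [zeroCol, hk]
    · simp only [zeroCol, hk, if_false]; fun_prop
  exact inner_indep_tail (X := fun ω i => U ω i j) (fun i => by fun_prop)
    (hind.precomp (g := fun i => (i, j)) fun i k h => by simpa using h) (fun i => hlaw i j)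
    ((measurable_dualVec T c).comp hz)
    ((indepFun_zeroCol hU hind j).comp (measurable_dualVec T c) measurable_id) ht hr

theorem dualVec_zeroCol {A : Fin m → Fin N → ℝ} {T : Finset (Fin N)} {j : Fin N} (hj : j ∉ T)
    (hinj : ∀ z : Fin N → ℝ, (∀ j ∉ T, z j = 0) →
      colComb (euclCol (Matrix.of A)) z = 0 → z = 0) (c : Fin N → ℝ) :
    (WithLp.toLp 2 (dualVec T c (zeroCol j A)) : EuclideanSpace ℝ (Fin m))
      = colComb (euclCol (Matrix.of A)) (dualCoef (euclCol (Matrix.of A)) T c) := by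
  have hcol : ∀ k, k ≠ j → euclCol (Matrix.of (zeroCol j A)) k = euclCol (Matrix.of A) k :=
    fun k hk => by simp [euclCol, zeroCol, hk]
  have h1 : dualCoef (euclCol (Matrix.of (zeroCol j A))) T c
      = dualCoef (euclCol (Matrix.of A)) T c :=
    dualCoef_congr (fun k hk => hcol k fun h => hj (h ▸ hk)) c
  rw [dualVec, ← colComb_euclCol, h1, Fintype.linearCombination_apply,
    Fintype.linearCombination_apply]
  refine Finset.sum_congr rfl fun k _ => ?_
  by_cases hk : k = j
  · rw [hk, (dualCoef_spec hinj c).1 j hj, zero_smul, zero_smul]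
  · rw [hcol k hk]

end GaussianMatrix

section Assembly

theorem measure_biUnion_le_ofReal {Ω ι : Type*} [MeasurableSpace Ω] {μ : Measure Ω}
    (s : Finset ι) {f : ι → Set Ω} {c : ℝ} (h : ∀ i ∈ s, μ (f i) ≤ ENNReal.ofReal c) :
    μ (⋃ i ∈ s, f i) ≤ ENNReal.ofReal (s.card * c) := by
  refine (measure_biUnion_finset_le s f).trans ((Finset.sum_le_card_nsmul s _ _ h).trans ?_)
  rw [nsmul_eq_mul, ENNReal.ofReal_mul (Nat.cast_nonneg _), ENNReal.ofReal_natCast]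

/-- On the complement of the three exceptional events, the LASSO recovers the support stably. -/
theorem condUL_lt_and_recovery_of_good {m N : ℕ} {A : Fin m → Fin N → ℝ} {v : Fin N → ℝ} {lam : ℝ}
    {Z : Finset (Fin N → ℝ)} (hne : (suppF v).Nonempty) (hm : 1 ≤ m) (hmN : m ≤ N) (hN : 4 ≤ N)
    (hSm : 4 * (suppF v).card ≤ m) (hlam : 2 / (N : ℝ) ^ 2 ≤ lam)
    (hlamv : 4 * lam < 2 * (m : ℝ) * minAbsOn v - 1 / (N : ℝ) ^ 2)
    (hZ : ∀ a : Fin N → EuclideanSpace ℝ (Fin m),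
      (∀ z ∈ Z, |‖colComb a z‖ ^ 2 - m * ∑ j, z j ^ 2| ≤ m / 8 * ∑ j, z j ^ 2) →
      ∀ z : Fin N → ℝ, (∀ j ∉ suppF v, z j = 0) →
        (m : ℝ) / 2 * ∑ j, z j ^ 2 ≤ ‖colComb a z‖ ^ 2)
    (h1 : ∀ z ∈ Z, ¬ (m : ℝ) / 8 * ∑ j, z j ^ 2 <
      |‖colComb (euclCol (Matrix.of A)) z‖ ^ 2 - m * ∑ j, z j ^ 2|)
    (h2 : ∀ j, ¬ (3 / 4 <
      |∑ i, dualVec ((suppF v).erase j) (fun k => Real.sign (v k)) (zeroCol j A) i * A i j| ∧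
      ∑ i, dualVec ((suppF v).erase j) (fun k => Real.sign (v k)) (zeroCol j A) i ^ 2
        ≤ 2 * (suppF v).card / m))
    (h3 : ∀ i j, ¬ (N : ℝ) < |A i j|) :
    condUL lam ((Matrix.of A).mulVec v) (Matrix.of A)
        < ENNReal.ofReal (542062 * (N : ℝ) ^ (7.5 : ℝ) * (max 1 (l2norm v)) ^ 5) ∧
      ∃ x : Fin N → ℝ, Sol lam ((Matrix.of A).mulVec v) (Matrix.of A) = {x} ∧
        supp x = supp v := by
  have hm0 : (0 : ℝ) < m := by exact_mod_cast hm
  have hG := hZ _ fun z hz => not_lt.1 (h1 z hz)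
  refine condUL_lt_and_recovery hne hm hmN hN hSm hG (fun j => ?_) (fun j => ?_) hlam hlamv
  · have hGe : ∀ z : Fin N → ℝ, (∀ k ∉ (suppF v).erase j, z k = 0) →
        (m : ℝ) / 2 * ∑ j, z j ^ 2 ≤ ‖colComb (euclCol (Matrix.of A)) z‖ ^ 2 := fun z hz =>
      hG z fun k hk => hz k fun h => hk (Finset.mem_of_mem_erase h)
    have hκ : (0 : ℝ) < m / 2 := by positivity
    have hu := dualVec_zeroCol (Finset.notMem_erase j _) (eq_zero_of_gram_lower hκ hGe)
      fun k => Real.sign (v k)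
    have hnorm := norm_sq_dual_le hκ hGe fun k => abs_sign_le_one (v k)
    have hcard : (((suppF v).erase j).card : ℝ) ≤ (suppF v).card := by
      exact_mod_cast Finset.card_erase_le
    rw [← hu, EuclideanSpace.real_norm_sq_eq] at hnorm
    have hsum : ∑ i, dualVec ((suppF v).erase j) (fun k => Real.sign (v k)) (zeroCol j A) i ^ 2
        ≤ 2 * (suppF v).card / m := by
      rw [le_div_iff₀ hm0]
      linarith
    have h := not_lt.1 fun hlt => h2 j ⟨hlt, hsum⟩
    rw [← hu]
    simpa [euclCol, PiLp.inner_apply] using h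
  · rw [sq]
    exact norm_toLp_le (fun i => not_lt.1 (h3 i j)) (Nat.cast_nonneg N) hmN

theorem net_failure_le {m s : ℕ} {l L : ℝ} (hL : 300 ≤ L) (hs : l - 1 ≤ s)
    (hm : 12 * s * L ≤ m) :
    (2 * 25 ^ s : ℝ) * (2 * exp (-(m : ℝ) / 512)) ≤ 11 * exp (-l / 2) := by
  have hs0 : (0 : ℝ) ≤ s := Nat.cast_nonneg s
  have h25 : (25 : ℝ) ≤ exp 4 := by
    have h : exp 4 = exp 1 ^ 4 := by rw [← Real.exp_nat_mul]; norm_num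
    rw [h]
    have := pow_le_pow_left₀ (by norm_num) (Real.exp_one_gt_d9.le) 4
    norm_num at this ⊢
    linarith
  have h1 : (25 : ℝ) ^ s ≤ exp (s * 4) := by
    rw [Real.exp_nat_mul]
    exact pow_le_pow_left₀ (by norm_num) h25 s
  have h2 : (7 : ℝ) * s ≤ m / 512 := by nlinarith
  calc (2 * 25 ^ s : ℝ) * (2 * exp (-(m : ℝ) / 512))
      ≤ (2 * exp (s * 4)) * (2 * exp (-(m : ℝ) / 512)) := by gcongr
    _ = 4 * exp (s * 4 + -(m : ℝ) / 512) := by rw [Real.exp_add]; ring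
    _ ≤ 4 * exp (1 + -l / 2) := by
        refine mul_le_mul_of_nonneg_left (Real.exp_le_exp.2 ?_) (by norm_num)
        have : -(m : ℝ) / 512 = -(m / 512) := by ring
        linarith
    _ = 4 * exp 1 * exp (-l / 2) := by rw [Real.exp_add]; ring
    _ ≤ 11 * exp (-l / 2) := by
        gcongr
        linarith [Real.exp_one_lt_d9]

theorem dual_failure_le {m s N : ℕ} {l L : ℝ} (hN : (N : ℝ) = exp l) (hs : 1 ≤ s) (hm1 : 1 ≤ m)
    (hL : l - 1 ≤ L) (hL0 : 0 ≤ L) (hm : 12 * s * L ≤ m) :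
    (N : ℝ) * (2 * exp (-(3 / 4 : ℝ) ^ 2 / (2 * (2 * (s : ℝ) / m)))) ≤ 15 * exp (-l / 2) := by
  have hs0 : (0 : ℝ) < s := by exact_mod_cast hs
  have hm0 : (0 : ℝ) < m := by exact_mod_cast hm1
  have h1 : -(3 / 4 : ℝ) ^ 2 / (2 * (2 * (s : ℝ) / m)) = -(9 / 64 * (m / s)) := by
    field_simp; norm_num
  have h2 : 12 * L ≤ m / s := by
    rw [le_div_iff₀ hs0]; linarith
  rw [h1, hN]
  calc exp l * (2 * exp (-(9 / 64 * (m / s) : ℝ))) = 2 * exp (l + -(9 / 64 * (m / s) : ℝ)) := by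
        rw [Real.exp_add]; ring
    _ ≤ 2 * exp (2 + -l / 2) := by
        refine mul_le_mul_of_nonneg_left (Real.exp_le_exp.2 ?_) (by norm_num)
        linarith
    _ = 2 * exp 1 ^ 2 * exp (-l / 2) := by
        rw [Real.exp_add, ← Real.exp_nat_mul]; norm_num; ring
    _ ≤ 15 * exp (-l / 2) := by
        gcongr
        nlinarith [Real.exp_one_lt_d9, Real.exp_pos 1]

theorem entry_failure_le {m N : ℕ} {l : ℝ} (hN : (N : ℝ) = exp l) (hl : 0 ≤ l) (hN6 : 6 ≤ N)
    (hmN : m ≤ N) :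
    ((m * N : ℕ) : ℝ) * (2 * exp (-(N : ℝ) ^ 2 / (2 * 1))) ≤ 2 * exp (-l / 2) := by
  have h6 : (6 : ℝ) ≤ N := by exact_mod_cast hN6
  have hmN' : (m : ℝ) ≤ N := by exact_mod_cast hmN
  have hlN : l ≤ N := by rw [hN]; linarith [Real.add_one_le_exp l]
  have h1 : -(N : ℝ) ^ 2 / (2 * 1) ≤ -(3 * l) := by
    rw [div_le_iff₀ (by norm_num)]; nlinarith
  push_cast
  calc (m * N : ℝ) * (2 * exp (-(N : ℝ) ^ 2 / (2 * 1)))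
      ≤ (N * N : ℝ) * (2 * exp (-(3 * l))) := by gcongr
    _ = 2 * exp (l + l + -(3 * l)) := by rw [hN, Real.exp_add, Real.exp_add]; ring
    _ ≤ 2 * exp (-l / 2) := by
        gcongr
        linarith

theorem regime_bounds {m N s : ℕ} (hs1 : Real.log ((N : ℝ) / 2) ≤ s) (hs2 : (s : ℝ) ≤ (N : ℝ) / 8)
    (hmN : (m : ℝ) ≤ (N : ℝ) / 9) {ε : ℝ} (hε0 : 0 < ε) (hε1 : ε < 1 / 2)
    (hε2 : 8 * Real.sqrt (s / (m : ℝ)) < ε)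
    (hε3 : (1 + ε) * 12 * (s : ℝ) * Real.log ((N : ℝ) - s) < m) :
    1 ≤ s ∧ 1 ≤ m ∧ 9 ≤ N ∧ m ≤ N ∧ 4 * s ≤ m ∧ 12 * s * Real.log ((N : ℝ) - s) ≤ m ∧
      0 ≤ Real.log ((N : ℝ) - s) ∧ Real.log N - 1 ≤ Real.log ((N : ℝ) - s) ∧
      Real.log N - 1 ≤ s := by
  have hm9 : 9 * m ≤ N := by
    have : (9 : ℝ) * m ≤ N := by linarith
    exact_mod_cast this
  have hs : 1 ≤ s := by
    by_contra! h0
    obtain rfl : s = 0 := by omega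
    simp only [Nat.cast_zero, mul_zero, zero_mul, Nat.cast_pos] at hε3 hs1
    have hN : (9 : ℝ) ≤ N := by exact_mod_cast (show 9 ≤ N by omega)
    linarith [Real.log_pos (show (1 : ℝ) < N / 2 by linarith)]
  have hsR : (1 : ℝ) ≤ s := by exact_mod_cast hs
  have hL0 : 0 ≤ Real.log ((N : ℝ) - s) := Real.log_nonneg (by linarith)
  have hsL : 0 ≤ 12 * s * Real.log ((N : ℝ) - s) := by positivity
  have hm12 : 12 * s * Real.log ((N : ℝ) - s) ≤ m := by nlinarith
  have hm : 1 ≤ m := by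
    by_contra! h0
    obtain rfl : m = 0 := by omega
    rw [Nat.cast_zero] at hε3
    nlinarith
  have hmR : (0 : ℝ) < m := by exact_mod_cast hm
  have h4 : 4 * s ≤ m := by
    have h1 : Real.sqrt (s / (m : ℝ)) ≤ 1 / 16 := by linarith
    have h2 := (Real.sqrt_le_left (by norm_num)).1 h1
    rw [div_le_iff₀ hmR] at h2
    have : (4 : ℝ) * s ≤ m := by linarith
    exact_mod_cast this
  have hlog : Real.log N - 1 ≤ Real.log ((N : ℝ) / 2) := by
    have hN0 : (N : ℝ) ≠ 0 := by exact_mod_cast (show N ≠ 0 by omega)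
    rw [Real.log_div hN0 (by norm_num)]
    linarith [Real.log_two_lt_d9]
  refine ⟨hs, hm, by omega, by omega, h4, hm12, hL0, hlog.trans ?_, hlog.trans hs1⟩
  exact Real.log_le_log (by linarith) (by linarith)

end Assembly

/-- For `v ∈ ℝ^N` with `s = |supp v|`, `ln(N/2) ≤ s ≤ N/8`, `m ≤ N/9`,
`U` with i.i.d. standard Gaussian entries and `b = Uv`: there are universal constants
`c̄ ≥ 1`, `C₁, C₂ > 0` such that under (i) `m > (1+ε)12s ln(N−s)` for some `ε ∈ (0,1/2)`
with `ε > 8√(s/m)`, (ii) `c̄λ < 2m·min_{j∈S}|v_j| − 1/N²`, and (iii) `λ ≥ 2/N²`,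
with probability at least `1 − C₁N^{−C₂}`: `C_UL(b,U) < 542062·N^{7.5}·⟨v⟩₂⁵` and the LASSO
problem has a unique minimiser `x`, with `supp(x) = supp(v)`. -/
theorem gaussian_lasso_trustworthy :
    ∃ cbar C1 C2 : ℝ, 1 ≤ cbar ∧ 0 < C1 ∧ 0 < C2 ∧
      ∀ (m N : ℕ) (lam : ℝ), 0 < lam →
      ∀ v : Fin N → ℝ,
        Real.log ((N : ℝ) / 2) ≤ ((suppF v).card : ℝ) →
        ((suppF v).card : ℝ) ≤ (N : ℝ) / 8 →
        (m : ℝ) ≤ (N : ℝ) / 9 →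
      ∀ (Ω : Type) [MeasurableSpace Ω] (μ : Measure Ω) [IsProbabilityMeasure μ]
        (U : Ω → Fin m → Fin N → ℝ), Measurable U →
        iIndepFun
          (fun p : Fin m × Fin N => fun ω => U ω p.1 p.2) μ →
        (∀ i j, Measure.map (fun ω => U ω i j) μ = gaussianReal 0 1) →
      -- (i)
      (∃ ε : ℝ, 0 < ε ∧ ε < 1 / 2 ∧ 8 * Real.sqrt ((suppF v).card / (m : ℝ)) < ε ∧
        (1 + ε) * 12 * ((suppF v).card : ℝ) * Real.log ((N : ℝ) - (suppF v).card)
          < (m : ℝ)) →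
      -- (ii)
      cbar * lam < 2 * (m : ℝ) * minAbsOn v - 1 / (N : ℝ) ^ 2 →
      -- (iii)
      2 / (N : ℝ) ^ 2 ≤ lam →
        ENNReal.ofReal (1 - C1 * (N : ℝ) ^ (-C2)) ≤
          μ {ω |
            condUL lam ((Matrix.of (U ω)).mulVec v) (Matrix.of (U ω)) <
              ENNReal.ofReal (542062 * (N : ℝ) ^ (7.5 : ℝ) * (max 1 (l2norm v)) ^ 5) ∧
            ∃ x : Fin N → ℝ,
              Sol lam ((Matrix.of (U ω)).mulVec v) (Matrix.of (U ω)) = {x} ∧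
              supp x = supp v} := by
  refine ⟨4, 30 + exp 151, 1 / 2, by norm_num, by positivity, by norm_num, ?_⟩
  rintro m N lam - v hs1 hs2 hmN Ω _ μ _ U hU hind hlaw ⟨ε, hε0, hε1, hε2, hε3⟩ hii hiii
  obtain ⟨hs, hm, hN9, hmN', h4, h12, hL0, hLl, hsl⟩ :=
    regime_bounds hs1 hs2 hmN hε0 hε1 hε2 hε3
  have hN0 : (0 : ℝ) < N := by exact_mod_cast (show 0 < N by omega)
  set s := (suppF v).card with hs_def
  set l := Real.log N with hl_def
  set L := Real.log ((N : ℝ) - s)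
  have hNl : (N : ℝ) = exp l := (Real.exp_log hN0).symm
  have hl0 : 0 ≤ l := Real.log_nonneg (by exact_mod_cast (show 1 ≤ N by omega))
  have hq : (N : ℝ) ^ (-(1 / 2) : ℝ) = exp (-l / 2) := by
    rw [Real.rpow_def_of_pos hN0]
    congr 1
    ring
  rw [hq]
  rcases lt_or_ge L 300 with hL | hL
  · rw [ENNReal.ofReal_of_nonpos]
    · exact zero_le
    · have h1 : 1 ≤ exp 151 * exp (-l / 2) := by
        rw [← Real.exp_add]
        exact Real.one_le_exp (by linarith)
      nlinarith [Real.exp_pos (-l / 2)]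
  obtain ⟨Z, hZc, hZ⟩ := exists_gram_test_of_support m (suppF v)
  set B₁ := ⋃ z ∈ Z, {ω | (m : ℝ) / 8 * ∑ j, z j ^ 2 <
    |‖colComb (euclCol (Matrix.of (U ω))) z‖ ^ 2 - m * ∑ j, z j ^ 2|} with hB₁
  set B₂ := ⋃ j ∈ (Finset.univ : Finset (Fin N)), {ω | 3 / 4 < |∑ i, dualVec ((suppF v).erase j)
      (fun k => Real.sign (v k)) (zeroCol j (U ω)) i * U ω i j| ∧
    ∑ i, dualVec ((suppF v).erase j) (fun k => Real.sign (v k)) (zeroCol j (U ω)) i ^ 2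
      ≤ 2 * (s : ℝ) / m} with hB₂
  set B₃ := ⋃ p ∈ (Finset.univ : Finset (Fin m × Fin N)), {ω | (N : ℝ) < |U ω p.1 p.2|} with hB₃
  set E := exp (-l / 2)
  have hE : 0 < E := Real.exp_pos _
  have hm0 : (0 : ℝ) < m := by exact_mod_cast hm
  have hs0 : (0 : ℝ) < s := by exact_mod_cast hs
  have hμ₁ : μ B₁ ≤ ENNReal.ofReal (11 * E) := by
    refine (measure_biUnion_le_ofReal Z fun z _ => gram_test_tail hU hind hlaw z).trans
      (ENNReal.ofReal_le_ofReal (le_trans ?_ (net_failure_le hL hsl h12)))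
    gcongr
    have h := (Nat.cast_le (α := ℝ)).2 hZc
    rwa [Nat.cast_mul, Nat.cast_pow] at h
  have hμ₂ : μ B₂ ≤ ENNReal.ofReal (15 * E) := by
    refine (measure_biUnion_le_ofReal _ fun j _ => dual_cert_tail hU hind hlaw _ _ j
      (t := 3 / 4) (r := 2 * (s : ℝ) / m) (by norm_num)
      (div_pos (mul_pos two_pos hs0) hm0)).trans (ENNReal.ofReal_le_ofReal ?_)
    rw [Finset.card_univ, Fintype.card_fin]
    exact dual_failure_le hNl hs hm hLl hL0 h12
  have hμ₃ : μ B₃ ≤ ENNReal.ofReal (2 * E) := by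
    refine (measure_biUnion_le_ofReal _ fun p _ => gaussianReal_abs_tail (hlaw p.1 p.2)
      hN0.le one_pos NNReal.coe_one.le).trans (ENNReal.ofReal_le_ofReal ?_)
    rw [Finset.card_univ, Fintype.card_prod, Fintype.card_fin, Fintype.card_fin]
    exact entry_failure_le hNl hl0 (by omega) hmN'
  set G := {ω | condUL lam ((Matrix.of (U ω)).mulVec v) (Matrix.of (U ω)) <
      ENNReal.ofReal (542062 * (N : ℝ) ^ (7.5 : ℝ) * (max 1 (l2norm v)) ^ 5) ∧
    ∃ x : Fin N → ℝ, Sol lam ((Matrix.of (U ω)).mulVec v) (Matrix.of (U ω)) = {x} ∧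
      supp x = supp v} with hG
  have hcover : Set.univ ⊆ G ∪ (B₁ ∪ B₂ ∪ B₃) := by
    intro ω _
    by_contra hω
    simp only [Set.mem_union, not_or] at hω
    obtain ⟨hωG, ⟨h₁, h₂⟩, h₃⟩ := hω
    simp only [hB₁, hB₂, hB₃, Set.mem_iUnion, Set.mem_ofPred_eq, not_exists, Finset.mem_univ,
      Prod.forall, exists_prop, true_and] at h₁ h₂ h₃
    exact hωG (condUL_lt_and_recovery_of_good (Finset.card_pos.1 hs) hm hmN' (by omega) h4 hiii
      hii hZ (fun z hz h => h₁ z ⟨hz, h⟩) h₂ h₃)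
  have hbad : μ (B₁ ∪ B₂ ∪ B₃) ≤ ENNReal.ofReal ((30 + exp 151) * E) := by
    calc μ (B₁ ∪ B₂ ∪ B₃) ≤ μ B₁ + μ B₂ + μ B₃ :=
          (measure_union_le _ _).trans (by gcongr; exact measure_union_le _ _)
      _ ≤ ENNReal.ofReal (11 * E) + ENNReal.ofReal (15 * E) + ENNReal.ofReal (2 * E) := by gcongr
      _ = ENNReal.ofReal (11 * E + 15 * E + 2 * E) := by
          rw [ENNReal.ofReal_add (by positivity) (by positivity),
            ENNReal.ofReal_add (by positivity) (by positivity)]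
      _ ≤ ENNReal.ofReal ((30 + exp 151) * E) := by
          refine ENNReal.ofReal_le_ofReal ?_
          nlinarith [Real.exp_pos 151]
  rw [ENNReal.ofReal_sub _ (by positivity), ENNReal.ofReal_one, tsub_le_iff_right]
  calc (1 : ℝ≥0∞) = μ Set.univ := measure_univ.symm
    _ ≤ μ (G ∪ (B₁ ∪ B₂ ∪ B₃)) := measure_mono hcover
    _ ≤ μ G + μ (B₁ ∪ B₂ ∪ B₃) := measure_union_le _ _
    _ ≤ μ G + ENNReal.ofReal ((30 + exp 151) * E) := by gcongr
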